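/- Let Ω₁ ⊆ ℂ be a generalized Jordan domain and let φ : Ω₁ → Ω₂ be a conformal homeomorphism onto a bounded domain Ω₂ ⊆ ℂ such that the connected components of ∂Ω₂ containing more than one point form a countable family {P_n} with Σ_n diam(P_n) < ∞, and the union of the singleton connected components of ∂Ω₂ has σ-finite linear measure. Then φ admits a continuous extension φ̄ : closure(Ω₁) → closure(Ω₂) if and only if ∂Ω₂ is a Peano compactum. -/

import Mathlib

open Set Metric Filter MeasureTheory Topology

noncomputable section

/-- A planar domain: a nonempty open connected subset of ℂ. -/
def IsPlanarDomain (D : Set ℂ) : Prop := D.Nonempty ∧ IsOpen D ∧ IsConnected D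

/-- A Peano compactum: a compact subset of ℂ all of whose connected components are
locally connected (as subspaces of ℂ) and such that for every `C > 0` only finitely
many components have diameter greater than `C`. -/
def IsPeanoCompactum (K : Set ℂ) : Prop :=
  IsCompact K ∧
  (∀ x ∈ K, LocallyConnectedSpace ↥(connectedComponentIn K x)) ∧
  ∀ C : ℝ, 0 < C →
    {Q : Set ℂ | (∃ x ∈ K, Q = connectedComponentIn K x) ∧ C < Metric.diam Q}.Finite

/-- A Jordan curve: a subset of ℂ homeomorphic to the unit circle. -/
def IsJordanCurve (J : Set ℂ) : Prop :=
  Nonempty (↥J ≃ₜ ↥(Metric.sphere (0:ℂ) 1))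

/-- A generalized Jordan domain: a bounded domain whose boundary is a Peano compactum,
each of whose boundary components is a single point or a Jordan curve. -/
def IsGeneralizedJordanDomain (D : Set ℂ) : Prop :=
  IsPlanarDomain D ∧ Bornology.IsBounded D ∧
  IsPeanoCompactum (frontier D) ∧
  ∀ x ∈ frontier D,
    connectedComponentIn (frontier D) x = {x} ∨
    IsJordanCurve (connectedComponentIn (frontier D) x)

/-- `φ` restricts to a homeomorphism of `D` onto `Ω`. -/
def IsHomeoOnto (φ : ℂ → ℂ) (D Ω : Set ℂ) : Prop :=
  ContinuousOn φ D ∧ Set.BijOn φ D Ω ∧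
  ∃ ψ : ℂ → ℂ, ContinuousOn ψ Ω ∧ Set.InvOn ψ φ D Ω

/-- `φ` is a conformal homeomorphism (holomorphic bijection) of `D` onto `Ω`. -/
def IsConformalHomeoOnto (φ : ℂ → ℂ) (D Ω : Set ℂ) : Prop :=
  DifferentiableOn ℂ φ D ∧ Set.BijOn φ D Ω

/-- `φb` is a continuous extension of `φ : D → Ω` to `closure D`, with values in `closure Ω`. -/
def ExtendsContinuously (φ φb : ℂ → ℂ) (D Ω : Set ℂ) : Prop :=
  ContinuousOn φb (closure D) ∧ Set.EqOn φb φ D ∧ Set.MapsTo φb (closure D) (closure Ω)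

/-- The oscDiam `σ_r(z₀) = diam φ(D ∩ C_r(z₀))`. -/
def oscDiam (φ : ℂ → ℂ) (D : Set ℂ) (z₀ : ℂ) (r : ℝ) : ℝ :=
  Metric.diam (φ '' (D ∩ Metric.sphere z₀ r))

/-- `liminf_{r→0⁺} σ_r(z₀) = 0`. -/
def OscLiminfZero (φ : ℂ → ℂ) (D : Set ℂ) (z₀ : ℂ) : Prop :=
  Filter.liminf (oscDiam φ D z₀) (nhdsWithin (0:ℝ) (Set.Ioi 0)) = 0

/-- A circle domain (normalized so that ∞ lies in a complementary disk): every bounded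
complementary component is a point or a closed round disk, and the unbounded
complementary component is the complement of an open round disk. -/
def IsCircleDomain (D : Set ℂ) : Prop :=
  IsPlanarDomain D ∧ Bornology.IsBounded D ∧
  ∀ x ∈ Dᶜ,
    (Bornology.IsBounded (connectedComponentIn Dᶜ x) →
      connectedComponentIn Dᶜ x = {x} ∨
      ∃ c : ℂ, ∃ rad : ℝ, 0 < rad ∧ connectedComponentIn Dᶜ x = Metric.closedBall c rad) ∧
    (¬ Bornology.IsBounded (connectedComponentIn Dᶜ x) →
      ∃ c : ℂ, ∃ rad : ℝ, 0 < rad ∧ connectedComponentIn Dᶜ x = (Metric.ball c rad)ᶜ)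

/-- A set has σ-finite linear (1-dimensional Hausdorff) measure. -/
def SigmaFiniteH1 (E : Set ℂ) : Prop :=
  ∃ f : ℕ → Set ℂ, (⋃ n, f n) = E ∧ ∀ n, μH[1] (f n) < ⊤

/-- The set of connected components of `K` containing more than one point. -/
def NondegComponents (K : Set ℂ) : Set (Set ℂ) :=
  {Q | (∃ x ∈ K, Q = connectedComponentIn K x) ∧ ∃ a ∈ Q, ∃ b ∈ Q, a ≠ b}

/-- The union of the singleton connected components of `K`. -/
def SingletonPart (K : Set ℂ) : Set ℂ :=
  {x | x ∈ K ∧ connectedComponentIn K x = {x}}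

/-- The cluster set `C(h, z₀) = ⋂_{r>0} closure h({z ∈ U : |z − z₀| < r})`. -/
def clusterSet (h : ℂ → ℂ) (U : Set ℂ) (z₀ : ℂ) : Set ℂ :=
  ⋂ r ∈ Set.Ioi (0:ℝ), closure (h '' (U ∩ Metric.ball z₀ r))

/-- The boundary component of `Ω` corresponding (under `φ : D → Ω`) to a boundary
component `Q` of `D`: `φ^B(Q) = ⋃_{z ∈ Q} C(φ, z)`. -/
def boundaryComp (φ : ℂ → ℂ) (D : Set ℂ) (Q : Set ℂ) : Set ℂ :=
  ⋃ z ∈ Q, clusterSet φ D z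

/-- An arc: the image of a continuous injective map from `[0,1]`. -/
def IsArc (A : Set ℂ) : Prop :=
  ∃ f : ℝ → ℂ, ContinuousOn f (Set.Icc 0 1) ∧ Set.InjOn f (Set.Icc 0 1) ∧
    f '' Set.Icc 0 1 = A

/-- An arc from `a` to `b`. -/
def IsArcFromTo (A : Set ℂ) (a b : ℂ) : Prop :=
  ∃ f : ℝ → ℂ, ContinuousOn f (Set.Icc 0 1) ∧ Set.InjOn f (Set.Icc 0 1) ∧
    f '' Set.Icc 0 1 = A ∧ f 0 = a ∧ f 1 = b

/-- Property S: for every `ε > 0`, `Ω` is a finite union of connected sets of diameter `< ε`. -/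
def PropertyS (Ω : Set ℂ) : Prop :=
  ∀ ε > (0:ℝ), ∃ (k : ℕ) (N : Fin k → Set ℂ),
    (∀ i, IsConnected (N i) ∧ Metric.diam (N i) < ε) ∧ (⋃ i, N i) = Ω

/-- `x ∈ ∂Ω` is locally accessible from `Ω`. -/
def LocallyAccessible (Ω : Set ℂ) (x : ℂ) : Prop :=
  ∀ ε > (0:ℝ), ∃ δ > (0:ℝ), ∀ z ∈ Ω, dist z x < δ →
    ∃ A : Set ℂ, IsArcFromTo A z x ∧ A ⊆ Ω ∪ {x} ∧ Metric.diam A < ε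

/-- `ξ ∈ ∂Ω` is locally sequentially accessible. -/
def LocallySeqAccessible (Ω : Set ℂ) (ξ : ℂ) : Prop :=
  ∀ r > (0:ℝ), ∀ ξn : ℕ → ℂ, (∀ n, ξn n ∈ Ω) → Filter.Tendsto ξn Filter.atTop (nhds ξ) →
    ∃ x ∈ Ω ∩ Metric.ball ξ r,
      {n : ℕ | ξn n ∈ connectedComponentIn (Ω ∩ Metric.ball ξ r) x}.Infinite

/-- `Ω` is finitely connected at the boundary point `x`. -/
def FinitelyConnectedAt (Ω : Set ℂ) (x : ℂ) : Prop :=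
  ∀ r > (0:ℝ), ∃ U : Set ℂ, IsOpen U ∧ x ∈ U ∧ U ⊆ Metric.ball x r ∧
    {Q : Set ℂ | ∃ y ∈ U ∩ Ω, Q = connectedComponentIn (U ∩ Ω) y}.Finite

/-- The diameter (Mazurkiewicz) distance on `Ω`. -/
def mazDist (Ω : Set ℂ) (x y : ℂ) : ℝ :=
  sInf (Metric.diam '' {E : Set ℂ | E ⊆ Ω ∧ IsConnected E ∧ x ∈ E ∧ y ∈ E})

/-- `Ω` is totally bounded for the Mazurkiewicz distance; for a metric space this is
equivalent to compactness of the metric completion of `(Ω, mazDist)`. -/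
def MazCompletionCompact (Ω : Set ℂ) : Prop :=
  ∀ ε > (0:ℝ), ∃ F : Finset ℂ, ↑F ⊆ Ω ∧ ∀ x ∈ Ω, ∃ y ∈ F, mazDist Ω x y < ε

/-- `f : A → B` is non-alternating: there are no `x, y ∈ B` and no separation of
`A \ f⁻¹({x})` into two disjoint nonempty relatively open sets `A₁, A₂` with
`y ∈ f(A₁) ∩ f(A₂)`. -/
def NonAlternatingOn (f : ℂ → ℂ) (A B : Set ℂ) : Prop :=
  ¬ ∃ x ∈ B, ∃ y ∈ B, ∃ A₁ A₂ : Set ℂ,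
      A₁.Nonempty ∧ A₂.Nonempty ∧ Disjoint A₁ A₂ ∧
      A₁ ∪ A₂ = {z | z ∈ A ∧ f z ≠ x} ∧
      (∃ U₁ : Set ℂ, IsOpen U₁ ∧ A₁ = U₁ ∩ {z | z ∈ A ∧ f z ≠ x}) ∧
      (∃ U₂ : Set ℂ, IsOpen U₂ ∧ A₂ = U₂ ∩ {z | z ∈ A ∧ f z ≠ x}) ∧
      y ∈ f '' A₁ ∧ y ∈ f '' A₂

open scoped ENNReal

/-- The function `w ↦ (w - x) / (w - y)` has a continuous logarithm on `X`. -/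
def HasRatioLog (X : Set ℂ) (x y : ℂ) : Prop :=
  ∃ g : ℂ → ℂ, ContinuousOn g X ∧ ∀ w ∈ X, Complex.exp (g w) * (w - y) = w - x

theorem eq_of_exp_eq_one_of_dist_lt {a b : ℂ} (ha : Complex.exp a = 1) (hb : Complex.exp b = 1)
    (h : dist a b < 1) : a = b := by
  have hab : Complex.exp (a - b) = 1 := by rw [Complex.exp_sub, ha, hb, div_one]
  obtain ⟨n, hn⟩ := Complex.exp_eq_one_iff.1 hab
  have hn0 : n = 0 := by
    by_contra hn0
    have h1 : (1 : ℝ) ≤ |(n : ℝ)| := by exact_mod_cast Int.one_le_abs hn0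
    rw [dist_eq_norm, hn] at h
    simp only [norm_mul, Complex.norm_intCast, Complex.norm_ofNat, Complex.norm_real,
      Complex.norm_I, mul_one, Real.norm_eq_abs, abs_of_pos Real.pi_pos] at h
    nlinarith [Real.pi_gt_three]
  rw [hn0] at hn
  simpa [sub_eq_zero] using hn

theorem isDiscrete_setOf_exp_eq_one : IsDiscrete {w : ℂ | Complex.exp w = 1} := by
  refine ⟨DiscreteTopology.of_forall_le_dist (r := 1) one_pos ?_⟩
  rintro ⟨a, ha⟩ ⟨b, hb⟩ hne
  by_contra! h
  exact hne (Subtype.ext (eq_of_exp_eq_one_of_dist_lt ha hb h))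

theorem IsPreconnected.eq_of_exp_eq_one {α : Type*} [TopologicalSpace α] {S : Set α}
    (hS : IsPreconnected S) {h : α → ℂ} (hc : ContinuousOn h S)
    (h1 : ∀ s ∈ S, Complex.exp (h s) = 1) {s t : α} (hs : s ∈ S) (ht : t ∈ S) : h s = h t :=
  hS.constant_of_mapsTo isDiscrete_setOf_exp_eq_one hc h1 hs ht

theorem ContinuousOn.eventually_eq_of_exp_eq_one {α : Type*} [TopologicalSpace α] {S : Set α}
    {h : α → ℂ} (hc : ContinuousOn h S)
    (h1 : ∀ s ∈ S, Complex.exp (h s) = 1) {t : α} (ht : t ∈ S) :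
    ∀ᶠ s in 𝓝[S] t, h s = h t := by
  filter_upwards [(hc t ht).eventually (Metric.ball_mem_nhds (h t) one_pos),
    self_mem_nhdsWithin] with s hs hsS
  exact eq_of_exp_eq_one_of_dist_lt (h1 s hsS) (h1 t ht) hs

theorem ContinuousOn.exists_exp_eq {α : Type*} [TopologicalSpace α] {S : Set α} {f : α → ℂ}
    (hc : ContinuousOn f S) (h : ∀ s ∈ S, ‖f s - 1‖ < 1) :
    ∃ g : α → ℂ, ContinuousOn g S ∧ ∀ s ∈ S, Complex.exp (g s) = f s := by
  have hsl : ∀ s ∈ S, f s ∈ Complex.slitPlane := by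
    intro s hs
    have := Complex.mem_slitPlane_of_norm_lt_one (h s hs)
    simpa using this
  exact ⟨fun s => Complex.log (f s), hc.clog hsl,
    fun s hs => Complex.exp_log (Complex.slitPlane_ne_zero (hsl s hs))⟩

namespace HasRatioLog

variable {X Y : Set ℂ} {x y z : ℂ}

theorem mono (h : HasRatioLog X x y) (hYX : Y ⊆ X) : HasRatioLog Y x y := by
  obtain ⟨g, hg, he⟩ := h
  exact ⟨g, hg.mono hYX, fun w hw => he w (hYX hw)⟩

theorem refl (X : Set ℂ) (x : ℂ) : HasRatioLog X x x :=
  ⟨fun _ => 0, continuousOn_const, fun w _ => by simp⟩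

theorem symm (h : HasRatioLog X x y) : HasRatioLog X y x := by
  obtain ⟨g, hg, he⟩ := h
  refine ⟨fun w => - g w, hg.neg, fun w hw => ?_⟩
  rw [← he w hw, ← mul_assoc, ← Complex.exp_add]
  simp

theorem trans (h : HasRatioLog X x y) (h' : HasRatioLog X y z) : HasRatioLog X x z := by
  obtain ⟨g, hg, he⟩ := h
  obtain ⟨g', hg', he'⟩ := h'
  refine ⟨fun w => g w + g' w, hg.add hg', fun w hw => ?_⟩
  rw [Complex.exp_add, mul_assoc, he' w hw, he w hw]

theorem of_dist_lt (h : ∀ w ∈ X, dist x y < dist w y) : HasRatioLog X x y := by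
  have hne : ∀ w ∈ X, w - y ≠ 0 := by
    intro w hw h0
    have := h w hw
    rw [sub_eq_zero.1 h0, dist_self] at this
    exact absurd this (not_lt.2 dist_nonneg)
  obtain ⟨g, hg, he⟩ := ContinuousOn.exists_exp_eq (S := X) (f := fun w => (w - x) / (w - y))
    (by
      refine ContinuousOn.div (by fun_prop) (by fun_prop) hne)
    (by
      intro w hw
      have h1 : (w - x) / (w - y) - 1 = (y - x) / (w - y) := by
        have := hne w hw
        field_simp
        ring
      rw [h1, norm_div, div_lt_one (norm_pos_iff.2 (hne w hw)), ← dist_eq_norm, ← dist_eq_norm,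
        dist_comm]
      exact h w hw)
  exact ⟨g, hg, fun w hw => by rw [he w hw, div_mul_cancel₀ _ (hne w hw)]⟩

theorem of_subset_closedBall {a : ℂ} {η : ℝ} (hX : X ⊆ closedBall a η)
    (hx : x ∉ closedBall a η) (hy : y ∉ closedBall a η) : HasRatioLog X x y := by
  have key : ∀ u ∉ closedBall a η, ∃ g : ℂ → ℂ, ContinuousOn g X ∧
      ∀ w ∈ X, Complex.exp (g w) * (a - u) = w - u := by
    intro u hu
    have hau : a - u ≠ 0 ∨ X = ∅ := by
      by_cases h0 : a - u = 0
      · right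
        rw [eq_empty_iff_forall_notMem]
        intro w hw
        apply hu
        rw [← sub_eq_zero.1 h0, mem_closedBall, dist_self]
        exact dist_nonneg.trans (hX hw)
      · exact Or.inl h0
    rcases hau with hau | rfl
    · obtain ⟨g, hg, he⟩ := ContinuousOn.exists_exp_eq (S := X) (f := fun w => (w - u) / (a - u))
        (by fun_prop)
        (by
          intro w hw
          have h1 : (w - u) / (a - u) - 1 = (w - a) / (a - u) := by
            field_simp
            ring
          rw [h1, norm_div, div_lt_one (norm_pos_iff.2 hau), ← dist_eq_norm, ← dist_eq_norm,
            dist_comm a u]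
          exact lt_of_le_of_lt (hX hw) (not_le.1 hu))
      exact ⟨g, hg, fun w hw => by rw [he w hw, div_mul_cancel₀ _ hau]⟩
    · exact ⟨fun _ => 0, continuousOn_empty _, by simp⟩
  obtain ⟨g, hg, he⟩ := key x hx
  obtain ⟨g', hg', he'⟩ := key y hy
  by_cases hXe : X = ∅
  · subst hXe
    exact ⟨fun _ => 0, continuousOn_empty _, by simp⟩
  obtain ⟨w₀, hw₀⟩ := Set.nonempty_iff_ne_empty.2 hXe
  have hax : a - x ≠ 0 := by
    intro h0
    apply hx
    rw [← sub_eq_zero.1 h0, mem_closedBall, dist_self]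
    exact dist_nonneg.trans (hX hw₀)
  have hay : a - y ≠ 0 := by
    intro h0
    apply hy
    rw [← sub_eq_zero.1 h0, mem_closedBall, dist_self]
    exact dist_nonneg.trans (hX hw₀)
  refine ⟨fun w => g w - g' w + Complex.log ((a - x) / (a - y)),
    (hg.sub hg').add continuousOn_const, fun w hw => ?_⟩
  rw [Complex.exp_add, Complex.exp_sub, Complex.exp_log (div_ne_zero hax hay), ← he w hw,
    ← he' w hw]
  field_simp

/-- Points joined by a connected set missing a closed set `X` are not separated by `X`. -/
theorem of_isPreconnected (hX : IsClosed X) {E : Set ℂ} (hE : IsPreconnected E)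
    (hEX : Disjoint E X) (hx : x ∈ E) (hy : y ∈ E) : HasRatioLog X x y := by
  have near : ∀ u ∉ X, ∀ᶠ v in 𝓝 u, HasRatioLog X v u := by
    intro u hu
    obtain ⟨s, hs, hsX⟩ := Metric.isOpen_iff.1 hX.isOpen_compl u hu
    filter_upwards [Metric.ball_mem_nhds u hs] with v hv
    refine of_dist_lt fun w hw => ?_
    by_contra! h
    exact hsX (lt_of_le_of_lt h hv : w ∈ ball u s) hw
  have hEX' : ∀ u ∈ E, u ∉ X := fun u hu hu' => (Set.disjoint_left.1 hEX) hu hu'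
  by_contra hcon
  have := hE {u | u ∉ X ∧ HasRatioLog X x u} {u | u ∉ X ∧ ¬ HasRatioLog X x u} ?_ ?_ ?_
    ⟨x, hx, hEX' x hx, HasRatioLog.refl X x⟩ ⟨y, hy, hEX' y hy, hcon⟩
  · obtain ⟨u, -, h1, h2⟩ := this
    exact h2.2 h1.2
  · rw [isOpen_iff_mem_nhds]
    rintro u ⟨hu, hxu⟩
    filter_upwards [near u hu, hX.isOpen_compl.mem_nhds hu] with v hv hvX
    exact ⟨hvX, hxu.trans hv.symm⟩
  · rw [isOpen_iff_mem_nhds]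
    rintro u ⟨hu, hxu⟩
    filter_upwards [near u hu, hX.isOpen_compl.mem_nhds hu] with v hv hvX
    exact ⟨hvX, fun h => hxu (h.trans hv)⟩
  · intro u hu
    by_cases h : HasRatioLog X x u
    · exact Or.inl ⟨hEX' u hu, h⟩
    · exact Or.inr ⟨hEX' u hu, h⟩

end HasRatioLog

/-- There is no continuous function `g` on a circle around `x` with
`exp (g w) = k * (w - x)`. -/
theorem not_exists_log_circle (x : ℂ) {R : ℝ} (hR : 0 < R) :
    ¬ ∃ g : ℂ → ℂ, ContinuousOn g (sphere x R) ∧ ∀ w ∈ sphere x R, Complex.exp (g w) = w - x := by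
  rintro ⟨g, hg, he⟩
  have hmem : ∀ θ : ℝ, circleMap x R θ ∈ sphere x R := fun θ => circleMap_mem_sphere x hR.le θ
  have hc : Continuous fun θ : ℝ => g (circleMap x R θ) - (θ * Complex.I + Real.log R) := by
    refine Continuous.sub ?_ (by fun_prop)
    exact hg.comp_continuous (continuous_circleMap x R) hmem
  have h1 : ∀ θ ∈ (univ : Set ℝ),
      Complex.exp (g (circleMap x R θ) - (θ * Complex.I + Real.log R)) = 1 := by
    intro θ _
    rw [Complex.exp_sub, he _ (hmem θ), Complex.exp_add, ← Complex.ofReal_exp, Real.exp_log hR,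
      circleMap]
    have := Complex.exp_ne_zero (θ * Complex.I)
    have hR' : (R : ℂ) ≠ 0 := by exact_mod_cast hR.ne'
    field_simp
    ring
  have h2 := isPreconnected_univ.eq_of_exp_eq_one hc.continuousOn h1 (mem_univ 0)
    (mem_univ (2 * Real.pi))
  have hp : circleMap x R (2 * Real.pi) = circleMap x R 0 := by
    simp [circleMap]
  rw [hp] at h2
  simp [Real.pi_ne_zero] at h2

theorem exists_log_sphere_of_ne_zero {F : ℂ → ℂ} (hF : Continuous F) (h0 : ∀ w, F w ≠ 0) (x : ℂ)
    {R : ℝ} (hR : 0 < R) :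
    ∃ g : ℂ → ℂ, ContinuousOn g (sphere x R) ∧ ∀ w ∈ sphere x R, Complex.exp (g w) = F w := by
  have hK : IsCompact (closedBall x R) := isCompact_closedBall x R
  obtain ⟨m, hm, hmF⟩ : ∃ m > 0, ∀ w ∈ closedBall x R, m ≤ ‖F w‖ := by
    obtain ⟨w, hw, hmin⟩ := hK.exists_isMinOn ⟨x, mem_closedBall_self hR.le⟩
      (hF.norm.continuousOn)
    exact ⟨‖F w‖, norm_pos_iff.2 (h0 w), fun v hv => hmin hv⟩
  have huc := hK.uniformContinuousOn_of_continuous hF.continuousOn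
  obtain ⟨δ, hδ, hδF⟩ := Metric.uniformContinuousOn_iff.1 huc m hm
  obtain ⟨N, hN⟩ := exists_nat_gt (R / δ)
  have hN0 : (0 : ℝ) < N := lt_of_le_of_lt (by positivity) hN
  have key : ∀ k : ℕ, k ≤ N → ∃ g : ℂ → ℂ, ContinuousOn g (sphere x R) ∧
      ∀ w ∈ sphere x R, Complex.exp (g w) = F (x + ((k / N : ℝ) : ℂ) * (w - x)) := by
    intro k
    induction k with
    | zero =>
      intro _
      exact ⟨fun _ => Complex.log (F x), continuousOn_const, fun w _ => by
        simp [Complex.exp_log (h0 x)]⟩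
    | succ k ih =>
      intro hk
      obtain ⟨g, hg, he⟩ := ih (by omega)
      have hin : ∀ j : ℕ, j ≤ N → ∀ w ∈ sphere x R,
          x + ((j / N : ℝ) : ℂ) * (w - x) ∈ closedBall x R := by
        intro j hj w hw
        rw [mem_closedBall, dist_eq_norm, add_sub_cancel_left, norm_mul, Complex.norm_real,
          ← dist_eq_norm, mem_sphere.1 hw, Real.norm_of_nonneg (by positivity)]
        have : (j : ℝ) / N ≤ 1 := by
          rw [div_le_one hN0]
          exact_mod_cast hj
        nlinarith
      obtain ⟨g', hg', he'⟩ := ContinuousOn.exists_exp_eq (S := sphere x R)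
        (f := fun w => F (x + (((k + 1 : ℕ) / N : ℝ) : ℂ) * (w - x)) /
          F (x + ((k / N : ℝ) : ℂ) * (w - x)))
        (by
          refine Continuous.continuousOn (Continuous.div ?_ ?_ fun _ => h0 _)
          · exact hF.comp (by fun_prop)
          · exact hF.comp (by fun_prop))
        (by
          intro w hw
          have hd := hδF _ (hin (k + 1) hk w hw) _ (hin k (by omega) w hw) (by
            rw [dist_eq_norm]
            have : x + (((k + 1 : ℕ) / N : ℝ) : ℂ) * (w - x) - (x + ((k / N : ℝ) : ℂ) * (w - x))
                = ((1 / N : ℝ) : ℂ) * (w - x) := by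
              push_cast
              ring
            rw [this, norm_mul, Complex.norm_real, ← dist_eq_norm, mem_sphere.1 hw,
              Real.norm_of_nonneg (by positivity)]
            rw [div_lt_iff₀ hδ] at hN
            rw [one_div, inv_mul_lt_iff₀ hN0]
            exact hN)
          have hb := hmF _ (hin k (by omega) w hw)
          have hne := h0 (x + ((k / N : ℝ) : ℂ) * (w - x))
          rw [div_sub_one hne, norm_div, div_lt_one (norm_pos_iff.2 hne), ← dist_eq_norm]
          exact hd.trans_le hb)
      refine ⟨fun w => g w + g' w, hg.add hg', fun w hw => ?_⟩
      rw [Complex.exp_add, he w hw, he' w hw, mul_div_cancel₀ _ (h0 _)]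
  obtain ⟨g, hg, he⟩ := key N le_rfl
  refine ⟨g, hg, fun w hw => ?_⟩
  rw [he w hw, div_self hN0.ne']
  simp

theorem isPreconnected_compl_closedBall_zero {R : ℝ} :
    IsPreconnected (closedBall (0 : ℂ) R)ᶜ := by
  rcases lt_or_ge R 0 with hR | hR
  · rw [closedBall_eq_empty.2 hR, compl_empty]
    exact isPreconnected_univ
  have : (closedBall (0 : ℂ) R)ᶜ =
      (fun p : ℝ × ℝ => circleMap 0 p.1 p.2) '' (Ioi R ×ˢ univ) := by
    ext w
    simp only [mem_compl_iff, mem_closedBall, dist_zero_right, not_le, mem_image, mem_prod, mem_Ioi,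
      mem_univ, and_true, Prod.exists]
    constructor
    · intro h
      exact ⟨‖w‖, Complex.arg w, h, by simp [circleMap]⟩
    · rintro ⟨r, θ, hr, rfl⟩
      simpa [circleMap, abs_of_pos (hR.trans_lt hr)] using hr
  rw [this]
  refine IsPreconnected.image (isPreconnected_Ioi.prod isPreconnected_univ) _ ?_
  unfold circleMap
  fun_prop

theorem frontier_connectedComponentIn_compl_subset {X : Set ℂ} (hX : IsClosed X) (x : ℂ) :
    frontier (connectedComponentIn Xᶜ x) ⊆ X := by
  intro p hp
  by_contra hpX
  have hU : IsOpen (connectedComponentIn Xᶜ x) := hX.isOpen_compl.connectedComponentIn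
  rw [hU.frontier_eq] at hp
  have hV : IsOpen (connectedComponentIn Xᶜ p) := hX.isOpen_compl.connectedComponentIn
  obtain ⟨q, hq, hq'⟩ := mem_closure_iff.1 hp.1 _ hV (mem_connectedComponentIn hpX)
  apply hp.2
  rw [connectedComponentIn_eq hq', ← connectedComponentIn_eq hq]
  exact mem_connectedComponentIn hpX

namespace HasRatioLog

variable {X Y : Set ℂ} {x y z : ℂ}

theorem mem_connectedComponentIn_of_isBounded (hX : IsCompact X) (hx : x ∉ X)
    (h : HasRatioLog X x y) (hU : Bornology.IsBounded (connectedComponentIn Xᶜ x)) :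
    y ∈ connectedComponentIn Xᶜ x := by
  by_contra hyU
  set U := connectedComponentIn Xᶜ x with hUdef
  have hxU : x ∈ U := mem_connectedComponentIn hx
  obtain ⟨g, hg, he⟩ := h
  obtain ⟨G, hG⟩ := ContinuousMap.exists_restrict_eq (Y := ℂ) hX.isClosed
    ⟨X.domRestrict g, continuousOn_iff_continuous_domRestrict.1 hg⟩
  have hGg : ∀ w ∈ X, G w = g w := fun w hw =>
    DFunLike.congr_fun hG ⟨w, hw⟩
  classical
  let F : ℂ → ℂ := fun w => if w ∈ U then Complex.exp (G w) * (w - y) else w - x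
  have hF : Continuous F := by
    refine Continuous.if ?_ (by fun_prop) (by fun_prop)
    intro w hw
    have hwX : w ∈ X := frontier_connectedComponentIn_compl_subset hX.isClosed x hw
    rw [hGg w hwX, he w hwX]
  have hF0 : ∀ w, F w ≠ 0 := by
    intro w
    by_cases hw : w ∈ U
    · simp only [F, if_pos hw]
      refine mul_ne_zero (Complex.exp_ne_zero _) (sub_ne_zero.2 ?_)
      rintro rfl
      exact hyU hw
    · simp only [F, if_neg hw]
      refine sub_ne_zero.2 ?_
      rintro rfl
      exact hw hxU
  obtain ⟨R, hR⟩ := hU.subset_ball_lt 0 x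
  obtain ⟨l, hl, hle⟩ := exists_log_sphere_of_ne_zero hF hF0 x hR.1
  refine not_exists_log_circle x hR.1 ⟨l, hl, fun w hw => ?_⟩
  rw [hle w hw]
  have : w ∉ U := fun hwU => by
    have h1 := hR.2 hwU
    rw [mem_ball, mem_sphere.1 hw] at h1
    exact lt_irrefl _ h1
  simp only [F, if_neg this]

/-- If `(w - x) / (w - y)` has a continuous logarithm on a compact set `X`, then `X` does not
separate `x` from `y`. -/
theorem exists_isPreconnected (hX : IsCompact X) (hx : x ∉ X) (hy : y ∉ X)
    (h : HasRatioLog X x y) : ∃ E, IsPreconnected E ∧ Disjoint E X ∧ x ∈ E ∧ y ∈ E := by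
  suffices hs : y ∈ connectedComponentIn Xᶜ x from
    ⟨connectedComponentIn Xᶜ x, isPreconnected_connectedComponentIn,
      Set.disjoint_left.2 fun w hw hwX => connectedComponentIn_subset _ _ hw hwX,
      mem_connectedComponentIn hx, hs⟩
  by_contra hyU
  obtain ⟨R, hR⟩ := hX.isBounded.subset_closedBall 0
  have hext : ∀ u ∉ X, ¬ Bornology.IsBounded (connectedComponentIn Xᶜ u) →
      (closedBall (0 : ℂ) R)ᶜ ⊆ connectedComponentIn Xᶜ u := by
    intro u hu hub
    have : ¬ connectedComponentIn Xᶜ u ⊆ closedBall 0 R :=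
      fun hh => hub (isBounded_closedBall.subset hh)
    obtain ⟨v, hv, hvR⟩ := Set.not_subset.1 this
    rw [connectedComponentIn_eq hv]
    exact isPreconnected_compl_closedBall_zero.subset_connectedComponentIn hvR
      (compl_subset_compl.2 hR)
  have h1 : ¬ Bornology.IsBounded (connectedComponentIn Xᶜ x) := fun hb =>
    hyU (h.mem_connectedComponentIn_of_isBounded hX hx hb)
  have h2 : ¬ Bornology.IsBounded (connectedComponentIn Xᶜ y) := fun hb => by
    have := h.symm.mem_connectedComponentIn_of_isBounded hX hy hb
    rw [← connectedComponentIn_eq this] at hyU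
    exact hyU (mem_connectedComponentIn hy)
  have h3 : ((R + 1 + |R| : ℝ) : ℂ) ∈ (closedBall (0 : ℂ) R)ᶜ := by
    simp only [mem_compl_iff, mem_closedBall, dist_zero_right, Complex.norm_real, not_le]
    have := le_abs_self R
    have := neg_abs_le R
    rw [Real.norm_of_nonneg (by linarith)]
    linarith [abs_nonneg R]
  have e1 := connectedComponentIn_eq (hext x hx h1 h3)
  have e2 := connectedComponentIn_eq (hext y hy h2 h3)
  rw [e1, ← e2] at hyU
  exact hyU (mem_connectedComponentIn hy)

end HasRatioLog

/-- A locally constant function on a closed subset of a compact set `A`, constant on the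
traces of the components of `A`, extends to a locally constant function on `A`. -/
theorem exists_continuousOn_extension {A B : Set ℂ} (hA : IsCompact A) (hB : IsCompact B)
    (hAB : ∀ x ∈ A, IsPreconnected (B ∩ connectedComponentIn A x)) {k : ℂ → ℂ}
    (hk : ContinuousOn k (A ∩ B)) (hk1 : ∀ w ∈ A ∩ B, Complex.exp (k w) = 1) :
    ∃ K : ℂ → ℂ, ContinuousOn K A ∧ (∀ w ∈ A, Complex.exp (K w) = 1) ∧ EqOn K k (A ∩ B) := by
  have : CompactSpace A := isCompact_iff_compactSpace.1 hA
  have hloc : ∀ a : A, ∃ V : Set A, IsClopen V ∧ a ∈ V ∧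
      ∃ c : ℂ, Complex.exp c = 1 ∧ ∀ w ∈ V, (w : ℂ) ∈ B → k w = c := by
    intro a
    obtain ⟨c, hc1, hc⟩ : ∃ c : ℂ, Complex.exp c = 1 ∧
        ∀ w ∈ B ∩ connectedComponentIn A a, k w = c := by
      rcases (B ∩ connectedComponentIn A a).eq_empty_or_nonempty with h | ⟨w₀, hw₀⟩
      · exact ⟨0, by simp, by simp [h]⟩
      · have hsub : B ∩ connectedComponentIn A a ⊆ A ∩ B :=
          fun w hw => ⟨connectedComponentIn_subset _ _ hw.2, hw.1⟩
        exact ⟨k w₀, hk1 w₀ (hsub hw₀), fun w hw =>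
          (hAB a a.2).eq_of_exp_eq_one (hk.mono hsub) (fun s hs => hk1 s (hsub hs)) hw hw₀⟩
    let O : Set A := {w | (w : ℂ) ∈ B → k w = c}
    have hO : IsOpen O := by
      rw [isOpen_iff_mem_nhds]
      intro w hw
      by_cases hwB : (w : ℂ) ∈ B
      · have h1 := hk.eventually_eq_of_exp_eq_one hk1 ⟨w.2, hwB⟩
        rw [eventually_nhdsWithin_iff] at h1
        have h2 := (continuous_subtype_val.tendsto w).eventually h1
        filter_upwards [h2] with v hv hvB
        rw [hv ⟨v.2, hvB⟩, hw hwB]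
      · have : IsOpen {v : A | (v : ℂ) ∉ B} :=
          hB.isClosed.isOpen_compl.preimage continuous_subtype_val
        filter_upwards [this.mem_nhds hwB] with v hv hvB
        exact absurd hvB hv
    have hsub : connectedComponent a ⊆ O := by
      intro w hw hwB
      refine hc w ⟨hwB, ?_⟩
      rw [connectedComponentIn_eq_image a.2]
      exact ⟨w, hw, rfl⟩
    rw [connectedComponent_eq_iInter_isClopen] at hsub
    have : Nonempty { s : Set A // IsClopen s ∧ a ∈ s } := ⟨⟨univ, isClopen_univ, mem_univ _⟩⟩
    obtain ⟨V, hV⟩ := exists_subset_nhds_of_compactSpace (V := fun s : { s : Set A // IsClopen s ∧ a ∈ s } => s.1)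
      (by
        rintro ⟨s, hs, has⟩ ⟨t, ht, hat⟩
        exact ⟨⟨s ∩ t, hs.inter ht, has, hat⟩, inter_subset_left, inter_subset_right⟩)
      (fun s => s.2.1.isClosed) (U := O) (fun w hw => hO.mem_nhds (hsub hw))
    exact ⟨V.1, V.2.1, V.2.2, c, hc1, fun w hw => hV hw⟩
  choose V hV haV c hc1 hc using hloc
  obtain ⟨t, ht⟩ := isCompact_univ.elim_finite_subcover V (fun a => (hV a).isOpen)
    (fun a _ => mem_iUnion.2 ⟨a, haV a⟩)
  have key : ∀ t : Finset A, ∃ K : A → ℂ, Continuous K ∧ (∀ w, Complex.exp (K w) = 1) ∧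
      ∀ w ∈ ⋃ a ∈ t, V a, (w : ℂ) ∈ B → K w = k w := by
    intro t
    classical
    induction t using Finset.induction_on with
    | empty => exact ⟨fun _ => 0, continuous_const, by simp, by simp⟩
    | insert a t _ ih =>
      obtain ⟨K, hK, hK1, hKk⟩ := ih
      refine ⟨fun w => if w ∈ V a then c a else K w, ?_, ?_, ?_⟩
      · refine Continuous.if ?_ continuous_const hK
        intro w hw
        have := (hV a).frontier_eq
        change w ∈ frontier (V a) at hw
        rw [this] at hw
        exact absurd hw (notMem_empty _)
      · intro w
        dsimp only
        split_ifs
        · exact hc1 a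
        · exact hK1 w
      · intro w hw hwB
        dsimp only
        split_ifs with hwa
        · exact (hc a w hwa hwB).symm
        · refine hKk w ?_ hwB
          simp only [Finset.mem_insert, iUnion_iUnion_eq_or_left, mem_union] at hw
          exact hw.resolve_left hwa
  obtain ⟨K, hK, hK1, hKk⟩ := key t
  classical
  refine ⟨fun w => if h : w ∈ A then K ⟨w, h⟩ else 0, ?_, ?_, ?_⟩
  · rw [continuousOn_iff_continuous_domRestrict]
    convert hK using 1
    ext w
    simp
  · intro w hw
    simp only [dif_pos hw, hK1]
  · intro w hw
    simp only [dif_pos hw.1]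
    exact hKk ⟨w, hw.1⟩ (ht (mem_univ _)) hw.2

/-- A form of Janiszewski's theorem. -/
theorem HasRatioLog.union {A B : Set ℂ} {x y : ℂ} (hA : IsCompact A) (hB : IsCompact B)
    (hAB : ∀ x ∈ A, IsPreconnected (B ∩ connectedComponentIn A x)) (hy : y ∉ A)
    (h : HasRatioLog A x y) (h' : HasRatioLog B x y) : HasRatioLog (A ∪ B) x y := by
  obtain ⟨g, hg, he⟩ := h
  obtain ⟨g', hg', he'⟩ := h'
  obtain ⟨K, hK, hK1, hKk⟩ := exists_continuousOn_extension hA hB hAB (k := fun w => g' w - g w)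
    ((hg'.mono inter_subset_right).sub (hg.mono inter_subset_left)) (by
      rintro w ⟨hwA, hwB⟩
      have h1 := he w hwA
      rw [← he' w hwB] at h1
      have hwy : w - y ≠ 0 := sub_ne_zero.2 (by rintro rfl; exact hy hwA)
      rw [Complex.exp_sub, mul_right_cancel₀ hwy h1, div_self (Complex.exp_ne_zero _)])
  classical
  have eB : EqOn (fun w => if w ∈ A then g w + K w else g' w) g' B := by
    intro w hw
    by_cases hwA : w ∈ A
    · simp only [if_pos hwA, hKk ⟨hwA, hw⟩]
      ring
    · simp only [if_neg hwA]
  have eA : EqOn (fun w => if w ∈ A then g w + K w else g' w) (fun w => g w + K w) A :=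
    fun w hw => if_pos hw
  refine ⟨fun w => if w ∈ A then g w + K w else g' w, ?_, ?_⟩
  · exact ((hg.add hK).congr eA).union_of_isClosed (hg'.congr eB) hA.isClosed hB.isClosed
  · rintro w (hw | hw)
    · rw [eA hw, Complex.exp_add, hK1 w hw, mul_one, he w hw]
    · rw [eB hw, he' w hw]

/-- A locally constant function on a relatively closed subset of an interval which takes the same
value at both ends of each gap is constant. -/
theorem eq_of_locally_constant_of_gaps {α : Type*} {I F : Set ℝ} (hI : I.OrdConnected)
    (hF : IsClosed F) {χ : ℝ → α} (hloc : ∀ t ∈ I ∩ F, ∀ᶠ s in 𝓝[I ∩ F] t, χ s = χ t)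
    (hgap : ∀ s ∈ I ∩ F, ∀ t ∈ I ∩ F, s < t → (∀ u ∈ Ioo s t, u ∉ F) → χ s = χ t)
    {a b : ℝ} (ha : a ∈ I ∩ F) (hb : b ∈ I ∩ F) : χ a = χ b := by
  wlog hab : a < b generalizing a b
  · rcases eq_or_lt_of_le (not_lt.1 hab) with h | h
    · rw [h]
    · exact (this hb ha h).symm
  have hIcc : Icc a b ⊆ I := hI.out ha.1 hb.1
  let S : Set ℝ := {t | t ∈ Icc a b ∩ F ∧ χ t = χ a}
  have haS : a ∈ S := ⟨⟨left_mem_Icc.2 hab.le, ha.2⟩, rfl⟩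
  have hSb : BddAbove S := ⟨b, fun t ht => ht.1.1.2⟩
  set s := sSup S with hs
  have hscl : s ∈ closure S := csSup_mem_closure ⟨a, haS⟩ hSb
  have hsF : s ∈ Icc a b ∩ F :=
    (closure_minimal (fun t ht => ht.1) (isClosed_Icc.inter hF) : closure S ⊆ _) hscl
  have hev : ∀ t ∈ Icc a b ∩ F, ∃ ε > 0, ∀ u ∈ Icc a b ∩ F, |u - t| < ε → χ u = χ t := by
    intro t ht
    have h := hloc t ⟨hIcc ht.1, ht.2⟩
    rw [eventually_nhdsWithin_iff, Metric.eventually_nhds_iff] at h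
    obtain ⟨ε, hε, h⟩ := h
    exact ⟨ε, hε, fun u hu hut => h hut ⟨hIcc hu.1, hu.2⟩⟩
  have hsS : χ s = χ a := by
    obtain ⟨ε, hε, h⟩ := hev s hsF
    obtain ⟨u, huS, hu⟩ := Metric.mem_closure_iff.1 hscl ε hε
    rw [← h u huS.1 (by rwa [abs_sub_comm]), huS.2]
  rcases eq_or_lt_of_le hsF.1.2 with hsb | hsb
  · rw [← hsb, hsS]
  exfalso
  let T : Set ℝ := {t | t ∈ Icc a b ∩ F ∧ s < t}
  have hbT : b ∈ T := ⟨⟨right_mem_Icc.2 hab.le, hb.2⟩, hsb⟩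
  have hTb : BddBelow T := ⟨s, fun t ht => ht.2.le⟩
  set t := sInf T with ht
  have htcl : t ∈ closure T := csInf_mem_closure ⟨b, hbT⟩ hTb
  have htF : t ∈ Icc a b ∩ F :=
    (closure_minimal (fun t ht => ht.1) (isClosed_Icc.inter hF) : closure T ⊆ _) htcl
  have hst : s ≤ t := le_csInf ⟨b, hbT⟩ fun u hu => hu.2.le
  have hmax : ∀ u ∈ Icc a b ∩ F, s < u → χ u ≠ χ s := fun u hu hsu he =>
    absurd (le_csSup hSb (⟨hu, he.trans hsS⟩ : u ∈ S)) (not_le.2 hsu)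
  rcases eq_or_lt_of_le hst with h | h
  · obtain ⟨ε, hε, h1⟩ := hev s hsF
    rw [← h] at htcl
    obtain ⟨u, huT, hu⟩ := Metric.mem_closure_iff.1 htcl ε hε
    exact hmax u huT.1 huT.2 (h1 u huT.1 (by rwa [abs_sub_comm]))
  · refine hmax t htF h (hgap s ⟨hIcc hsF.1, hsF.2⟩ t ⟨hIcc htF.1, htF.2⟩ h ?_).symm
    intro u hu huF
    have : t ≤ u := csInf_le hTb ⟨⟨⟨hsF.1.1.trans hu.1.le, hu.2.le.trans htF.1.2⟩, huF⟩, hu.1⟩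
    exact absurd this (not_le.2 hu.2)

theorem exists_log_circleMap_ratio {c z z' : ℂ} {r : ℝ} (hr : 0 < r)
    (hz : z ∈ ball c r) (hz' : z' ∉ closedBall c r) :
    ∃ F : ℝ → ℂ, Continuous F ∧
      (∀ θ, Complex.exp (F θ) * (circleMap c r θ - z') = circleMap c r θ - z) ∧
      ∀ θ, F (θ + 2 * Real.pi) = F θ + 2 * Real.pi * Complex.I := by
  obtain ⟨g, hg, he⟩ : HasRatioLog (sphere c r) z c :=
    HasRatioLog.of_dist_lt fun w hw => by rw [mem_sphere.1 hw]; exact hz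
  have hcz' : c - z' ≠ 0 := sub_ne_zero.2 (by
    rintro rfl
    exact hz' (mem_closedBall_self hr.le))
  obtain ⟨g', hg', he'⟩ := ContinuousOn.exists_exp_eq (S := sphere c r)
    (f := fun w => (w - z') / (c - z')) (by fun_prop) (by
      intro w hw
      rw [div_sub_one hcz', norm_div, div_lt_one (norm_pos_iff.2 hcz'), sub_sub_sub_cancel_right,
        ← dist_eq_norm, ← dist_eq_norm, mem_sphere.1 hw, dist_comm]
      exact not_le.1 hz')
  have hmem : ∀ θ : ℝ, circleMap c r θ ∈ sphere c r := fun θ => circleMap_mem_sphere c hr.le θ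
  have hper : ∀ θ : ℝ, circleMap c r (θ + 2 * Real.pi) = circleMap c r θ := fun θ =>
    periodic_circleMap c r θ
  have hrne : (r : ℂ) ≠ 0 := by exact_mod_cast hr.ne'
  refine ⟨fun θ => g (circleMap c r θ) - g' (circleMap c r θ) +
    (θ * Complex.I + Complex.log (r / (c - z'))), ?_, ?_, ?_⟩
  · exact ((hg.comp_continuous (continuous_circleMap c r) hmem).sub
      (hg'.comp_continuous (continuous_circleMap c r) hmem)).add (by fun_prop)
  · intro θ
    have h1 := he _ (hmem θ)
    have h2 := he' _ (hmem θ)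
    rw [eq_div_iff hcz'] at h2
    rw [Complex.exp_add, Complex.exp_add, Complex.exp_sub, Complex.exp_log (div_ne_zero hrne hcz'),
      ← h2, ← h1]
    have h3 : circleMap c r θ - c = r * Complex.exp (θ * Complex.I) := by
      simp [circleMap]
    rw [h3]
    have := Complex.exp_ne_zero (g' (circleMap c r θ))
    field_simp
  · intro θ
    simp only [hper]
    push_cast
    ring

/-- If a continuum `Q` together with a circle around `z` that does not surround `z'` are given,
then one of the complementary arcs of `Q` in the circle, together with `Q`, separates `z`
from `z'`. -/
theorem exists_arc_not_hasRatioLog {Q : Set ℂ} (hQ : IsClosed Q) (hQc : IsPreconnected Q)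
    {c z z' : ℂ} {r : ℝ} (hr : 0 < r) (hz : z ∈ ball c r) (hz' : z' ∉ closedBall c r)
    (hz'Q : z' ∉ Q) :
    ∃ I : Set ℝ, I.OrdConnected ∧ (∀ θ ∈ I, circleMap c r θ ∉ Q) ∧
      IsClosed (Q ∪ circleMap c r '' I) ∧ ¬ HasRatioLog (Q ∪ circleMap c r '' I) z z' := by
  by_contra! hcon
  obtain ⟨F, hF, hFe, hFp⟩ := exists_log_circleMap_ratio hr hz hz'
  have hper : ∀ θ : ℝ, circleMap c r (θ + 2 * Real.pi) = circleMap c r θ := fun θ =>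
    periodic_circleMap c r θ
  have h2pi : (2 * Real.pi * Complex.I : ℂ) ≠ 0 := Complex.two_pi_I_ne_zero
  have hcz' : ∀ θ, circleMap c r θ - z' ≠ 0 := fun θ => sub_ne_zero.2 (by
    rintro rfl
    exact hz' (sphere_subset_closedBall (circleMap_mem_sphere c hr.le θ)))
  have hcont : ∀ {A : Set ℂ} {g : ℂ → ℂ} {S : Set ℝ}, ContinuousOn g A →
      (∀ θ ∈ S, circleMap c r θ ∈ A) → ContinuousOn (fun θ => F θ - g (circleMap c r θ)) S :=
    fun hg hS => hF.continuousOn.sub (hg.comp (continuous_circleMap c r).continuousOn hS)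
  have hexp : ∀ {g : ℂ → ℂ} {θ : ℝ},
      Complex.exp (g (circleMap c r θ)) * (circleMap c r θ - z') = circleMap c r θ - z →
      Complex.exp (F θ - g (circleMap c r θ)) = 1 := by
    intro g θ h
    rw [← hFe θ] at h
    rw [Complex.exp_sub, mul_right_cancel₀ (hcz' θ) h, div_self (Complex.exp_ne_zero _)]
  by_cases hT : ∃ θ, circleMap c r θ ∈ Q
  · obtain ⟨θ₀, hθ₀⟩ := hT
    obtain ⟨g, hg, he⟩ := (hcon ∅ ordConnected_empty (by simp) (by simpa using hQ)).mono
      subset_union_left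
    have hFcl : IsClosed {θ | circleMap c r θ ∈ Q} := hQ.preimage (continuous_circleMap c r)
    have hc := hcont (S := univ ∩ {θ | circleMap c r θ ∈ Q}) hg fun θ hθ => hθ.2
    have h1 : F θ₀ - g (circleMap c r θ₀) =
        F (θ₀ + 2 * Real.pi) - g (circleMap c r (θ₀ + 2 * Real.pi)) := by
      refine eq_of_locally_constant_of_gaps (χ := fun θ => F θ - g (circleMap c r θ))
        ordConnected_univ hFcl
        (fun t ht => hc.eventually_eq_of_exp_eq_one (fun s hs => hexp (he _ hs.2)) ht) ?_
        ⟨mem_univ _, hθ₀⟩ ⟨mem_univ _, by simpa [hper] using hθ₀⟩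
      rintro s ⟨-, hs⟩ t ⟨-, ht⟩ hst hgap
      have hcl : Q ∪ circleMap c r '' Ioo s t = Q ∪ circleMap c r '' Icc s t := by
        refine subset_antisymm (union_subset_union_right _ (image_mono Ioo_subset_Icc_self)) ?_
        rintro w (hw | ⟨θ, hθ, rfl⟩)
        · exact Or.inl hw
        · rcases eq_or_lt_of_le hθ.1 with h | h
          · exact Or.inl (h ▸ hs)
          · rcases eq_or_lt_of_le hθ.2 with h' | h'
            · exact Or.inl (h' ▸ ht)
            · exact Or.inr ⟨θ, ⟨h, h'⟩, rfl⟩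
      obtain ⟨g₁, hg₁, he₁⟩ := hcon (Ioo s t) ordConnected_Ioo hgap (by
        rw [hcl]
        exact hQ.union (isCompact_Icc.image (continuous_circleMap c r)).isClosed)
      rw [hcl] at hg₁ he₁
      have e1 := isPreconnected_Icc.eq_of_exp_eq_one
        (hcont (S := Icc s t) hg₁ fun θ hθ => Or.inr ⟨θ, hθ, rfl⟩)
        (fun θ hθ => hexp (he₁ _ (Or.inr ⟨θ, hθ, rfl⟩))) (left_mem_Icc.2 hst.le)
        (right_mem_Icc.2 hst.le)
      have e2 := hQc.eq_of_exp_eq_one (h := fun w => g₁ w - g w)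
        ((hg₁.mono subset_union_left).sub hg) (fun w hw => by
          have hwz : w - z' ≠ 0 := sub_ne_zero.2 (by rintro rfl; exact hz'Q hw)
          have h := he w hw
          rw [← he₁ w (Or.inl hw)] at h
          rw [Complex.exp_sub, mul_right_cancel₀ hwz h, div_self (Complex.exp_ne_zero _)]) hs ht
      show _ = _
      linear_combination e1 + e2
    rw [hFp, hper] at h1
    apply h2pi
    linear_combination -h1
  · push Not at hT
    have hun : circleMap c r '' univ = sphere c r := by
      rw [image_univ, range_circleMap, abs_of_pos hr]
    obtain ⟨g, hg, he⟩ := hcon univ ordConnected_univ (fun θ _ => hT θ) (by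
      rw [hun]
      exact hQ.union isClosed_sphere)
    have h1 := isPreconnected_univ.eq_of_exp_eq_one
      (hcont (S := univ) hg fun θ hθ => Or.inr ⟨θ, hθ, rfl⟩)
      (fun θ hθ => hexp (he _ (Or.inr ⟨θ, hθ, rfl⟩))) (mem_univ 0) (mem_univ (0 + 2 * Real.pi))
    rw [hFp, hper] at h1
    apply h2pi
    linear_combination -h1

/-- Two boundary points in different components of the compact set `K` are separated. -/
theorem exists_isClosed_separation {K : Set ℂ} (hK : IsCompact K) {x y : ℂ} (hx : x ∈ K)
    (hy : y ∈ K) (h : y ∉ connectedComponentIn K x) :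
    ∃ A B : Set ℂ, IsClosed A ∧ IsClosed B ∧ Disjoint A B ∧ A ∪ B = K ∧ x ∈ A ∧ y ∈ B := by
  have : CompactSpace K := isCompact_iff_compactSpace.1 hK
  rw [connectedComponentIn_eq_image hx, connectedComponent_eq_iInter_isClopen] at h
  have h' : ∃ Z : Set K, IsClopen Z ∧ (⟨x, hx⟩ : K) ∈ Z ∧ (⟨y, hy⟩ : K) ∉ Z := by
    by_contra! hcon
    refine h ⟨⟨y, hy⟩, ?_, rfl⟩
    rw [mem_iInter]
    rintro ⟨Z, hZ, hxZ⟩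
    exact hcon Z hZ hxZ
  obtain ⟨Z, hZ, hxZ, hyZ⟩ := h'
  refine ⟨(↑) '' Z, (↑) '' Zᶜ, ?_, ?_, ?_, ?_, ⟨_, hxZ, rfl⟩, ⟨_, hyZ, rfl⟩⟩
  · exact hK.isClosed.isClosedEmbedding_subtypeVal.isClosedMap _ hZ.1
  · exact hK.isClosed.isClosedEmbedding_subtypeVal.isClosedMap _ hZ.compl.1
  · exact (disjoint_image_iff Subtype.val_injective).2 disjoint_compl_right
  · rw [← image_union, union_compl_self, image_univ, Subtype.range_coe]

/-- Two points of a bounded domain which are not separated by `B` are joined by a connected set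
missing `B`. -/
theorem HasRatioLog.exists_isPreconnected_subset {Ω B : Set ℂ} (hΩ : IsOpen Ω)
    (hΩc : IsPreconnected Ω) (hΩb : Bornology.IsBounded Ω) (hB : IsCompact B)
    (hcomp : ∀ x ∈ frontier Ω, IsPreconnected (B ∩ connectedComponentIn (frontier Ω) x))
    {a b : ℂ} (ha : a ∈ Ω \ B) (hb : b ∈ Ω \ B) (h : HasRatioLog B a b) :
    ∃ E, IsPreconnected E ∧ E ⊆ Ω \ B ∧ a ∈ E ∧ b ∈ E := by
  have hdisj : Disjoint Ω (frontier Ω) := disjoint_frontier_iff_isOpen.2 hΩ |>.symm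
  have hfc : IsCompact (frontier Ω) :=
    hΩb.isCompact_closure.of_isClosed_subset isClosed_frontier frontier_subset_closure
  have h1 : HasRatioLog (frontier Ω) a b :=
    .of_isPreconnected isClosed_frontier hΩc hdisj ha.1 hb.1
  have hna : a ∉ frontier Ω := disjoint_left.1 hdisj ha.1
  have hnb : b ∉ frontier Ω := disjoint_left.1 hdisj hb.1
  obtain ⟨E, hE, hd, haE, hbE⟩ := (HasRatioLog.union hfc hB hcomp hnb h1 h).exists_isPreconnected
    (hfc.union hB) (by simp [hna, ha.2]) (by simp [hnb, hb.2])
  rw [disjoint_union_right] at hd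
  refine ⟨E, hE, fun w hw => ⟨?_, disjoint_left.1 hd.2 hw⟩, haE, hbE⟩
  refine hE.subset_of_closure_inter_subset hΩ ⟨a, haE, ha.1⟩ (fun v hv => ?_) hw
  by_contra hvΩ
  exact disjoint_left.1 hd.1 hv.2 ⟨hv.1, by rwa [hΩ.interior_eq]⟩

/-- A homeomorphism between bounded domains, together with its inverse. -/
structure IsDomainHomeo (φ ψ : ℂ → ℂ) (U V : Set ℂ) : Prop where
  isOpen_source : IsOpen U
  isOpen_target : IsOpen V
  isConnected_source : IsConnected U
  isConnected_target : IsConnected V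
  isBounded_source : Bornology.IsBounded U
  isBounded_target : Bornology.IsBounded V
  continuousOn : ContinuousOn φ U
  continuousOn_symm : ContinuousOn ψ V
  mapsTo : MapsTo φ U V
  mapsTo_symm : MapsTo ψ V U
  left_inv : ∀ z ∈ U, ψ (φ z) = z
  right_inv : ∀ p ∈ V, φ (ψ p) = p

/-- The closure of the graph of `φ` over `U`. -/
def closedGraph (φ : ℂ → ℂ) (U : Set ℂ) : Set (ℂ × ℂ) := closure ((fun z => (z, φ z)) '' U)

namespace IsDomainHomeo

variable {φ ψ : ℂ → ℂ} {U V : Set ℂ}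

theorem symm (H : IsDomainHomeo φ ψ U V) : IsDomainHomeo ψ φ V U :=
  ⟨H.2, H.1, H.4, H.3, H.6, H.5, H.8, H.7, H.10, H.9, H.12, H.11⟩

theorem swap_mem (H : IsDomainHomeo φ ψ U V) {z p : ℂ} (h : (z, p) ∈ closedGraph φ U) :
    (p, z) ∈ closedGraph ψ V := by
  have := image_closure_subset_closure_image (continuous_swap (X := ℂ) (Y := ℂ))
    (mem_image_of_mem Prod.swap h)
  refine closure_mono ?_ this
  rintro _ ⟨_, ⟨z, hz, rfl⟩, rfl⟩
  exact ⟨φ z, H.mapsTo hz, by simp [H.left_inv z hz]⟩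

theorem mk_mem (z : ℂ) (hz : z ∈ U) : (z, φ z) ∈ closedGraph φ U :=
  subset_closure ⟨z, hz, rfl⟩

theorem isCompact_closedGraph (H : IsDomainHomeo φ ψ U V) : IsCompact (closedGraph φ U) := by
  refine ((H.isBounded_source.prod H.isBounded_target).subset ?_).isCompact_closure
  rintro _ ⟨z, hz, rfl⟩
  exact ⟨hz, H.mapsTo hz⟩

theorem fst_mem_closure (_H : IsDomainHomeo φ ψ U V) {z p : ℂ} (h : (z, p) ∈ closedGraph φ U) :
    z ∈ closure U := by
  have := image_closure_subset_closure_image (continuous_fst (X := ℂ) (Y := ℂ))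
    (mem_image_of_mem Prod.fst h)
  refine closure_mono ?_ this
  rintro _ ⟨_, ⟨z, hz, rfl⟩, rfl⟩
  exact hz

theorem snd_eq (H : IsDomainHomeo φ ψ U V) {z p : ℂ} (h : (z, p) ∈ closedGraph φ U) (hz : z ∈ U) :
    p = φ z := by
  obtain ⟨u, hu, hut⟩ := mem_closure_iff_seq_limit.1 h
  choose w hw hwu using hu
  have h1 : Tendsto w atTop (𝓝 z) := by
    have := (continuous_fst.tendsto _).comp hut
    exact this.congr fun n => by simp [← hwu n]
  have h2 : Tendsto (fun n => φ (w n)) atTop (𝓝 p) := by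
    have := (continuous_snd.tendsto _).comp hut
    exact this.congr fun n => by simp [← hwu n]
  exact tendsto_nhds_unique h2
    (((H.continuousOn.continuousAt (H.isOpen_source.mem_nhds hz)).tendsto).comp h1)

theorem exists_mem (H : IsDomainHomeo φ ψ U V) {z : ℂ} (hz : z ∈ closure U) :
    ∃ p, (z, p) ∈ closedGraph φ U := by
  have : closure U ⊆ Prod.fst '' closedGraph φ U :=
    closure_minimal (fun w hw => ⟨_, mk_mem w hw, rfl⟩)
      (H.isCompact_closedGraph.image continuous_fst).isClosed
  obtain ⟨⟨_, p⟩, h, rfl⟩ := this hz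
  exact ⟨p, h⟩

theorem snd_mem_frontier (H : IsDomainHomeo φ ψ U V) {z p : ℂ} (h : (z, p) ∈ closedGraph φ U)
    (hz : z ∈ frontier U) : p ∈ frontier V := by
  rw [H.isOpen_target.frontier_eq]
  refine ⟨H.symm.fst_mem_closure (H.swap_mem h), fun hp => ?_⟩
  have := H.symm.snd_eq (H.swap_mem h) hp
  rw [H.isOpen_source.frontier_eq] at hz
  exact hz.2 (this ▸ H.mapsTo_symm hp)

theorem isCompact_frontier (H : IsDomainHomeo φ ψ U V) : IsCompact (frontier U) :=
  H.isBounded_source.isCompact_closure.of_isClosed_subset isClosed_frontier frontier_subset_closure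

/-- The image of a compact set under the closed graph relation is compact. -/
theorem isCompact_image (H : IsDomainHomeo φ ψ U V) {S : Set ℂ} (hS : IsClosed S) :
    IsCompact {p | ∃ z ∈ S, (z, p) ∈ closedGraph φ U} := by
  have : {p | ∃ z ∈ S, (z, p) ∈ closedGraph φ U} =
      Prod.snd '' (closedGraph φ U ∩ Prod.fst ⁻¹' S) := by
    ext p
    constructor
    · rintro ⟨z, hz, h⟩
      exact ⟨(z, p), ⟨h, hz⟩, rfl⟩
    · rintro ⟨⟨z, _⟩, ⟨h, hz⟩, rfl⟩
      exact ⟨z, hz, h⟩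
  rw [this]
  exact (H.isCompact_closedGraph.inter_right (hS.preimage continuous_fst)).image continuous_snd

/-- A separation of the boundary is witnessed by a compact subset of the domain. -/
theorem exists_isCompact_of_separation (H : IsDomainHomeo φ ψ U V) {A B : Set ℂ} (hA : IsClosed A)
    (hB : IsClosed B) (hAB : Disjoint A B) (hU : A ∪ B = frontier U) :
    ∃ O P C : Set ℂ, IsOpen O ∧ IsOpen P ∧ A ⊆ O ∧ B ⊆ P ∧ IsCompact C ∧ C ⊆ U ∧ Disjoint O C ∧
      Disjoint P C ∧ ∀ E : Set ℂ, IsPreconnected E → E ⊆ U \ C → ∀ a ∈ O, ∀ b ∈ P, a ∈ E → b ∉ E := by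
  obtain ⟨O, P, hO, hP, hAO, hBP, hOP⟩ := normal_separation hA hB hAB
  refine ⟨O, P, closure U \ (O ∪ P), hO, hP, hAO, hBP,
    H.isBounded_source.isCompact_closure.diff (hO.union hP), fun w hw => ?_, ?_, ?_, ?_⟩
  · by_contra h
    have : w ∈ frontier U := by
      rw [H.isOpen_source.frontier_eq]
      exact ⟨hw.1, h⟩
    rw [← hU] at this
    exact hw.2 (this.imp (@hAO w) (@hBP w))
  · exact disjoint_left.2 fun w hw hw' => hw'.2 (Or.inl hw)
  · exact disjoint_left.2 fun w hw hw' => hw'.2 (Or.inr hw)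
  · intro E hE hEU a ha b hb haE hbE
    obtain ⟨w, -, hw⟩ := hE O P hO hP (fun w hw => by
      by_contra h
      exact (hEU hw).2 ⟨subset_closure (hEU hw).1, h⟩) ⟨a, haE, ha⟩ ⟨b, hbE, hb⟩
    exact disjoint_left.1 hOP hw.1 hw.2

theorem disjoint_images_of_separation (H : IsDomainHomeo φ ψ U V) {A B : Set ℂ} (hA : IsClosed A)
    (hB : IsClosed B) (hAB : Disjoint A B) (hU : A ∪ B = frontier U) {a b p : ℂ} (ha : a ∈ A)
    (hb : b ∈ B) (hap : (a, p) ∈ closedGraph φ U) (hbp : (b, p) ∈ closedGraph φ U) : False := by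
  obtain ⟨O, P, C, hO, hP, hAO, hBP, hC, hCU, -, -, hsep⟩ :=
    H.exists_isCompact_of_separation hA hB hAB hU
  have hφC : IsCompact (φ '' C) := hC.image_of_continuousOn (H.continuousOn.mono hCU)
  have hφCV : φ '' C ⊆ V := by
    rintro _ ⟨w, hw, rfl⟩
    exact H.mapsTo (hCU hw)
  have hpV : p ∈ frontier V := H.snd_mem_frontier hap (hU ▸ Or.inl ha)
  have hpC : p ∉ φ '' C := fun h => by
    rw [H.isOpen_target.frontier_eq] at hpV
    exact hpV.2 (hφCV h)
  obtain ⟨ε, hε, hball⟩ := Metric.isOpen_iff.1 hφC.isClosed.isOpen_compl p hpC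
  obtain ⟨_, ⟨hzO, hzε⟩, z, hz, rfl⟩ := mem_closure_iff.1 hap (O ×ˢ ball p ε)
    (hO.prod isOpen_ball) ⟨hAO ha, mem_ball_self hε⟩
  obtain ⟨_, ⟨hwP, hwε⟩, w, hw, rfl⟩ := mem_closure_iff.1 hbp (P ×ˢ ball p ε)
    (hP.prod isOpen_ball) ⟨hBP hb, mem_ball_self hε⟩
  dsimp only at hzO hzε hwP hwε
  have hlog : HasRatioLog (φ '' C) (φ z) (φ w) :=
    .of_isPreconnected hφC.isClosed (convex_ball p ε).isPreconnected
      (disjoint_left.2 fun v hv => hball hv) hzε hwε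
  obtain ⟨E, hE, hEV, hzE, hwE⟩ := hlog.exists_isPreconnected_subset H.isOpen_target
    H.isConnected_target.isPreconnected H.isBounded_target hφC (fun x _ => by
      convert isPreconnected_empty
      rw [← disjoint_iff_inter_eq_empty]
      exact ((disjoint_frontier_iff_isOpen.2 H.isOpen_target).symm.mono_left hφCV).mono_right
        (connectedComponentIn_subset _ _)) ⟨H.mapsTo hz, hball hzε⟩ ⟨H.mapsTo hw, hball hwε⟩
  refine hsep (ψ '' E) (hE.image ψ (H.continuousOn_symm.mono fun v hv => (hEV hv).1)) ?_ z hzO w hwP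
    ⟨_, hzE, H.left_inv z hz⟩ ⟨_, hwE, H.left_inv w hw⟩
  rintro _ ⟨v, hv, rfl⟩
  exact ⟨H.mapsTo_symm (hEV hv).1,
    fun h => (hEV hv).2 ⟨_, h, H.right_inv v (hEV hv).1⟩⟩

/-- Boundary points related to the same boundary component lie in the same boundary component. -/
theorem mem_connectedComponentIn_of_mem (H : IsDomainHomeo φ ψ U V) {z z' p p' : ℂ}
    (h : (z, p) ∈ closedGraph φ U) (h' : (z', p') ∈ closedGraph φ U) (hz : z ∈ frontier U)
    (hz' : z' ∈ frontier U) (hp : p' ∈ connectedComponentIn (frontier V) p) :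
    z' ∈ connectedComponentIn (frontier U) z := by
  by_contra hcon
  obtain ⟨A, B, hA, hB, hAB, hU, hzA, hzB⟩ :=
    exists_isClosed_separation H.isCompact_frontier hz hz' hcon
  obtain ⟨q, -, ⟨a, ha, haq⟩, ⟨b, hb, hbq⟩⟩ := isPreconnected_closed_iff.1
    (isPreconnected_connectedComponentIn (F := frontier V) (x := p)) _ _
    (H.isCompact_image hA).isClosed (H.isCompact_image hB).isClosed (fun q hq => by
      have hqV := connectedComponentIn_subset _ _ hq
      obtain ⟨w, hw⟩ := H.symm.exists_mem (frontier_subset_closure hqV)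
      have hwU := H.symm.snd_mem_frontier hw hqV
      rw [← hU] at hwU
      exact hwU.imp (fun hwA => ⟨w, hwA, H.symm.swap_mem hw⟩)
        (fun hwB => ⟨w, hwB, H.symm.swap_mem hw⟩))
    ⟨p, mem_connectedComponentIn (H.snd_mem_frontier h hz), z, hzA, h⟩ ⟨p', hp, z', hzB, h'⟩
  exact H.disjoint_images_of_separation hA hB hAB hU ha hb haq hbq

theorem mem_connectedComponentIn_iff (H : IsDomainHomeo φ ψ U V) {z z' p p' : ℂ}
    (h : (z, p) ∈ closedGraph φ U) (h' : (z', p') ∈ closedGraph φ U) (hz : z ∈ frontier U)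
    (hz' : z' ∈ frontier U) : p' ∈ connectedComponentIn (frontier V) p ↔
      z' ∈ connectedComponentIn (frontier U) z :=
  ⟨H.mem_connectedComponentIn_of_mem h h' hz hz', H.symm.mem_connectedComponentIn_of_mem
    (H.swap_mem h) (H.swap_mem h') (H.snd_mem_frontier h hz) (H.snd_mem_frontier h' hz')⟩

/-- A connected set missing the domain touches at most one boundary component. -/
theorem mem_connectedComponentIn_of_isPreconnected (H : IsDomainHomeo φ ψ U V) {E : Set ℂ}
    (hE : IsPreconnected E) (hEU : Disjoint E U) {q q' : ℂ} (hq : q ∈ E) (hq' : q' ∈ E)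
    (hqU : q ∈ frontier U) (hqU' : q' ∈ frontier U) :
    q' ∈ connectedComponentIn (frontier U) q := by
  by_contra hcon
  obtain ⟨A, B, hA, hB, hAB, hU, hqA, hqB⟩ :=
    exists_isClosed_separation H.isCompact_frontier hqU hqU' hcon
  obtain ⟨O, P, C, hO, hP, hAO, hBP, hC, hCU, hOC, hPC, hsep⟩ :=
    H.exists_isCompact_of_separation hA hB hAB hU
  obtain ⟨ε, hε, hb⟩ := Metric.isOpen_iff.1 hO q (hAO hqA)
  obtain ⟨ε', hε', hb'⟩ := Metric.isOpen_iff.1 hP q' (hBP hqB)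
  obtain ⟨z, hzb, hz⟩ := mem_closure_iff.1 (frontier_subset_closure hqU) _ isOpen_ball
    (mem_ball_self hε)
  obtain ⟨w, hwb, hw⟩ := mem_closure_iff.1 (frontier_subset_closure hqU') _ isOpen_ball
    (mem_ball_self hε')
  have hpre : IsPreconnected (ball q ε ∪ E ∪ ball q' ε') :=
    (((convex_ball q ε).isPreconnected).union q (mem_ball_self hε) hq hE).union q' (Or.inr hq')
      (mem_ball_self hε') (convex_ball q' ε').isPreconnected
  have hlog : HasRatioLog C z w := by
    refine .of_isPreconnected hC.isClosed hpre ?_ (Or.inl (Or.inl hzb)) (Or.inr hwb)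
    simp only [disjoint_union_left]
    exact ⟨⟨hOC.mono_left hb, hEU.mono_right hCU⟩, hPC.mono_left hb'⟩
  obtain ⟨F, hF, hFU, hzF, hwF⟩ := hlog.exists_isPreconnected_subset H.isOpen_source
    H.isConnected_source.isPreconnected H.isBounded_source hC (fun x _ => by
      convert isPreconnected_empty
      rw [← disjoint_iff_inter_eq_empty]
      exact ((disjoint_frontier_iff_isOpen.2 H.isOpen_source).symm.mono_left hCU).mono_right
        (connectedComponentIn_subset _ _)) ⟨hz, disjoint_left.1 hOC (hb hzb)⟩
    ⟨hw, disjoint_left.1 hPC (hb' hwb)⟩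
  exact hsep F hF hFU z (hb hzb) w (hb' hwb) hzF hwF

end IsDomainHomeo

theorem isClosed_connectedComponentIn_of_isClosed {K : Set ℂ} (hK : IsClosed K) (x : ℂ) :
    IsClosed (connectedComponentIn K x) := by
  by_cases hx : x ∈ K
  · rw [connectedComponentIn_eq_image hx]
    exact hK.isClosedEmbedding_subtypeVal.isClosedMap _ isClosed_connectedComponent
  · rw [connectedComponentIn_eq_empty hx]
    exact isClosed_empty

/-- A locally connected compact set has small connected subsets which are uniformly large. -/
theorem exists_isPreconnected_between {P : Set ℂ} (hP : IsCompact P) (hl : LocallyConnectedSpace P)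
    {η : ℝ} (hη : 0 < η) : ∃ ε > 0, ∀ a ∈ P, ∃ M ⊆ P, IsClosed M ∧ IsPreconnected M ∧
      P ∩ closedBall a ε ⊆ M ∧ M ⊆ closedBall a η := by
  have h1 : ∀ x (hx : x ∈ P), ∃ M ⊆ P, IsClosed M ∧ IsPreconnected M ∧ M ∈ 𝓝[P] x ∧
      M ⊆ closedBall x (η / 2) := by
    intro x hx
    obtain ⟨S, hSU, hS, hxS, hSc⟩ := locallyConnectedSpace_iff_subsets_isOpen_isConnected.1 hl
      ⟨x, hx⟩ (closedBall _ (η / 2)) (closedBall_mem_nhds _ (half_pos hη))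
    refine ⟨closure ((↑) '' S), closure_minimal ?_ hP.isClosed, isClosed_closure,
      (hSc.isPreconnected.image _ continuous_subtype_val.continuousOn).closure, ?_,
      closure_minimal ?_ isClosed_closedBall⟩
    · rintro _ ⟨w, -, rfl⟩
      exact w.2
    · refine mem_of_superset ?_ subset_closure
      rw [nhdsWithin_eq_map_subtype_coe hx]
      exact image_mem_map (hS.mem_nhds hxS)
    · rintro _ ⟨w, hw, rfl⟩
      exact hSU hw
  choose M hMP hMc hMp hMn hMb using h1
  obtain ⟨δ, hδ, h⟩ := lebesgue_number_lemma_of_emetric_nhdsWithin' hP hMn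
  obtain ⟨ε, hε0, hεδ⟩ := ENNReal.lt_iff_exists_nnreal_btwn.1 hδ
  refine ⟨ε, by exact_mod_cast hε0, fun a ha => ?_⟩
  obtain ⟨y, hy⟩ := h a ha
  have hsub : P ∩ closedBall a ε ⊆ M y y.2 := by
    intro w hw
    refine hy ⟨?_, hw.1⟩
    rw [mem_eball, edist_nndist]
    refine lt_of_le_of_lt ?_ hεδ
    exact_mod_cast hw.2
  refine ⟨M y y.2, hMP _ _, hMc _ _, hMp _ _, hsub, fun w hw => ?_⟩
  have haM := hMb _ _ (hsub ⟨ha, mem_closedBall_self ε.2⟩)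
  have hwM := hMb _ _ hw
  rw [mem_closedBall] at *
  linarith [dist_triangle_right w a y]

theorem exists_arc_compl_subset_ball {Q : Set ℂ} {z₀ : ℂ} (hz₀ : z₀ ∈ Q)
    (hQ : Q = {z₀} ∨ IsJordanCurve Q) {ρ : ℝ} (hρ : 0 < ρ) :
    ∃ β ⊆ Q, IsCompact β ∧ IsPreconnected β ∧ z₀ ∉ β ∧ Q \ β ⊆ ball z₀ ρ := by
  rcases hQ with hQ | ⟨⟨h⟩⟩
  · refine ⟨∅, empty_subset _, isCompact_empty, isPreconnected_empty, notMem_empty _, ?_⟩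
    rw [hQ, sdiff_empty, singleton_subset_iff]
    exact mem_ball_self hρ
  · set w₀ : ℂ := ((h ⟨z₀, hz₀⟩ : sphere (0 : ℂ) 1) : ℂ) with hw₀
    have hw₀1 : ‖w₀‖ = 1 := mem_sphere_zero_iff_norm.1 (h ⟨z₀, hz₀⟩).2
    have hw₀0 : w₀ ≠ 0 := by
      rintro h0
      rw [h0, norm_zero] at hw₀1
      exact zero_ne_one hw₀1
    have hmem : ∀ θ : ℝ, w₀ * Complex.exp (θ * Complex.I) ∈ sphere (0 : ℂ) 1 := fun θ => by
      rw [mem_sphere_zero_iff_norm, norm_mul, hw₀1, Complex.norm_exp_ofReal_mul_I, one_mul]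
    let γ : ℝ → ℂ := fun θ => h.symm ⟨_, hmem θ⟩
    have hγ : Continuous γ := by
      refine continuous_subtype_val.comp (h.symm.continuous.comp ?_)
      exact Continuous.subtype_mk (by fun_prop) _
    have hγ0 : γ 0 = z₀ := by
      have : (⟨_, hmem 0⟩ : sphere (0 : ℂ) 1) = h ⟨z₀, hz₀⟩ := Subtype.ext (by simp [hw₀])
      simp only [γ, this, h.symm_apply_apply]
    have hγ1 : ∀ θ, γ θ = z₀ → Complex.exp (θ * Complex.I) = 1 := by
      intro θ hθ
      have h1 : h.symm ⟨_, hmem θ⟩ = ⟨z₀, hz₀⟩ := Subtype.ext hθ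
      have h2 : (⟨_, hmem θ⟩ : sphere (0 : ℂ) 1) = h ⟨z₀, hz₀⟩ := by
        rw [← h1, h.apply_symm_apply]
      have h3 : w₀ * Complex.exp (θ * Complex.I) = w₀ := congrArg Subtype.val h2
      exact mul_left_cancel₀ hw₀0 (h3.trans (mul_one _).symm)
    have hγp : ∀ θ, γ (θ + 2 * Real.pi) = γ θ := by
      intro θ
      have : (⟨_, hmem (θ + 2 * Real.pi)⟩ : sphere (0 : ℂ) 1) = ⟨_, hmem θ⟩ := Subtype.ext (by
        push_cast
        rw [add_mul, Complex.exp_periodic])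
      simp only [γ, this]
    have hγs : ∀ q ∈ Q, ∃ θ ∈ Ioc (-Real.pi) Real.pi, γ θ = q := by
      intro q hq
      have hq1 : ‖((h ⟨q, hq⟩ : sphere (0 : ℂ) 1) : ℂ)‖ = 1 := mem_sphere_zero_iff_norm.1 (h ⟨q, hq⟩).2
      refine ⟨_, Complex.arg_mem_Ioc (((h ⟨q, hq⟩ : sphere (0 : ℂ) 1) : ℂ) / w₀), ?_⟩
      have : (⟨_, hmem (Complex.arg (((h ⟨q, hq⟩ : sphere (0 : ℂ) 1) : ℂ) / w₀))⟩ : sphere (0 : ℂ) 1) = h ⟨q, hq⟩ :=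
        Subtype.ext (by
          have := Complex.norm_mul_exp_arg_mul_I (((h ⟨q, hq⟩ : sphere (0 : ℂ) 1) : ℂ) / w₀)
          rw [norm_div, hq1, hw₀1, div_one, Complex.ofReal_one, one_mul] at this
          simp only [this]
          exact mul_div_cancel₀ _ hw₀0)
      simp only [γ, this, h.symm_apply_apply]
    obtain ⟨t', ht', hball⟩ := Metric.continuousAt_iff.1 (hγ.continuousAt (x := 0)) ρ hρ
    set t := min t' Real.pi with htdef
    have ht0 : 0 < t := lt_min ht' Real.pi_pos
    have htpi : t ≤ Real.pi := min_le_right _ _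
    refine ⟨γ '' Icc t (2 * Real.pi - t), ?_, isCompact_Icc.image hγ,
      isPreconnected_Icc.image _ hγ.continuousOn, ?_, ?_⟩
    · rintro _ ⟨θ, -, rfl⟩
      exact (h.symm ⟨_, hmem θ⟩).2
    · rintro ⟨θ, hθ, hθ0⟩
      obtain ⟨n, hn⟩ := Complex.exp_eq_one_iff.1 (hγ1 θ hθ0)
      have hn' : θ = n * (2 * Real.pi) := by
        have := congrArg Complex.im hn
        simpa using this
      have h1 : (0 : ℝ) < n := by
        by_contra! hcon
        nlinarith [hθ.1, Real.pi_pos]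
      have h2 : (n : ℝ) < 1 := by
        by_contra! hcon
        nlinarith [hθ.2, Real.pi_pos]
      have h3 : (0 : ℤ) < n := by exact_mod_cast h1
      have h4 : n < (1 : ℤ) := by exact_mod_cast h2
      omega
    · rintro q ⟨hq, hqβ⟩
      obtain ⟨θ, hθ, rfl⟩ := hγs q hq
      by_cases hlt : |θ| < t
      · rw [mem_ball, ← hγ0]
        exact hball (by simpa using hlt.trans_le (min_le_left _ _))
      · exfalso
        refine hqβ ?_
        rcases le_abs.1 (not_lt.1 hlt) with h' | h'
        · exact ⟨θ, ⟨h', by linarith [hθ.2]⟩, rfl⟩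
        · exact ⟨θ + 2 * Real.pi, ⟨by linarith [hθ.1], by linarith⟩, hγp θ⟩

namespace IsDomainHomeo

variable {φ ψ : ℂ → ℂ} {U V : Set ℂ}

/-- If the closed graph is single-valued over `closure U` then `φ` extends continuously. -/
theorem exists_extendsContinuously (H : IsDomainHomeo φ ψ U V)
    (h : ∀ z ∈ frontier U, ∀ p p', (z, p) ∈ closedGraph φ U → (z, p') ∈ closedGraph φ U → p = p') :
    ∃ φb, ExtendsContinuously φ φb U V := by
  have huniq : ∀ z ∈ closure U, ∀ p p', (z, p) ∈ closedGraph φ U → (z, p') ∈ closedGraph φ U →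
      p = p' := by
    intro z hz p p' hp hp'
    by_cases hzU : z ∈ U
    · rw [H.snd_eq hp hzU, H.snd_eq hp' hzU]
    · exact h z (by rw [H.isOpen_source.frontier_eq]; exact ⟨hz, hzU⟩) p p' hp hp'
  have hlim : ∀ z ∈ closure U, ∀ p, (z, p) ∈ closedGraph φ U → Tendsto φ (𝓝[U] z) (𝓝 p) := by
    intro z hz p hp
    refine H.isBounded_target.isCompact_closure.tendsto_nhds_of_unique_mapClusterPt ?_ ?_
    · filter_upwards [self_mem_nhdsWithin] with w hw
      exact subset_closure (H.mapsTo hw)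
    · intro q _ hq
      refine huniq z hz q p ?_ hp
      refine mem_closure_iff_nhds.2 fun t ht => ?_
      obtain ⟨O, hO, S, hS, hOS⟩ := mem_nhds_prod_iff.1 ht
      obtain ⟨w, hwS, hwO, hwU⟩ := ((mapClusterPt_iff_frequently.1 hq S hS).and_eventually
        (inter_mem (mem_nhdsWithin_of_mem_nhds hO) self_mem_nhdsWithin)).exists
      exact ⟨(w, φ w), hOS ⟨hwO, hwS⟩, w, hwU, rfl⟩
  have hex : ∀ z ∈ closure U, ∃ p, Tendsto φ (𝓝[U] z) (𝓝 p) := fun z hz =>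
    let ⟨p, hp⟩ := H.exists_mem hz
    ⟨p, hlim z hz p hp⟩
  refine ⟨extendFrom U φ, continuousOn_extendFrom subset_rfl hex,
    fun z hz => extendFrom_extends H.continuousOn z hz, fun z hz => ?_⟩
  obtain ⟨p, hp⟩ := H.exists_mem hz
  rw [extendFrom_eq hz (hlim z hz p hp)]
  exact H.symm.fst_mem_closure (H.swap_mem hp)

theorem closedGraph_eq_of_extendsContinuously {φb : ℂ → ℂ}
    (h : ExtendsContinuously φ φb U V) {z p : ℂ} (hp : (z, p) ∈ closedGraph φ U) : p = φb z := by
  obtain ⟨u, hu, hut⟩ := mem_closure_iff_seq_limit.1 hp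
  choose w hw hwu using hu
  have h1 : Tendsto w atTop (𝓝 z) := by
    have := (continuous_fst.tendsto _).comp hut
    exact this.congr fun n => by simp [← hwu n]
  have h2 : Tendsto (fun n => φ (w n)) atTop (𝓝 p) := by
    have := (continuous_snd.tendsto _).comp hut
    exact this.congr fun n => by simp [← hwu n]
  have hz : z ∈ closure U := mem_closure_of_tendsto h1 (.of_forall hw)
  have h3 : Tendsto (fun n => φb (w n)) atTop (𝓝 (φb z)) :=
    (h.1 z hz).tendsto.comp (tendsto_nhdsWithin_iff.2 ⟨h1, .of_forall fun n =>
      subset_closure (hw n)⟩)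
  exact tendsto_nhds_unique h2 (h3.congr fun n => h.2.1 (hw n))

/-- A continuous extension transports local connectedness of boundary components. -/
theorem locallyConnectedSpace_of_extendsContinuously (H : IsDomainHomeo φ ψ U V) {φb : ℂ → ℂ}
    (h : ExtendsContinuously φ φb U V)
    (hU : ∀ x ∈ frontier U, LocallyConnectedSpace (connectedComponentIn (frontier U) x))
    {p : ℂ} (hp : p ∈ frontier V) : LocallyConnectedSpace (connectedComponentIn (frontier V) p) := by
  obtain ⟨z, hz⟩ := H.symm.exists_mem (frontier_subset_closure hp)
  have hzU := H.symm.snd_mem_frontier hz hp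
  have hzp := H.symm.swap_mem hz
  have hgr : ∀ w ∈ closure U, (w, φb w) ∈ closedGraph φ U := by
    intro w hw
    obtain ⟨q, hq⟩ := H.exists_mem hw
    rwa [← closedGraph_eq_of_extendsContinuously h hq]
  have hQU : connectedComponentIn (frontier U) z ⊆ frontier U := connectedComponentIn_subset _ _
  have := hU z hzU
  have : CompactSpace (connectedComponentIn (frontier U) z) := isCompact_iff_compactSpace.1
    (H.isCompact_frontier.of_isClosed_subset
      (isClosed_connectedComponentIn_of_isClosed isClosed_frontier _) hQU)
  have hmaps : MapsTo φb (connectedComponentIn (frontier U) z)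
      (connectedComponentIn (frontier V) p) := fun w hw =>
    (H.mem_connectedComponentIn_iff hzp (hgr w (frontier_subset_closure (hQU hw))) hzU
      (hQU hw)).2 hw
  have hcont : Continuous (hmaps.restrict φb _ _) :=
    (h.1.mono (hQU.trans frontier_subset_closure)).mapsToRestrict hmaps
  refine (hcont.isClosedMap.isQuotientMap hcont ?_).isCoinducing.locallyConnectedSpace
  rintro ⟨q, hq⟩
  have hqV := connectedComponentIn_subset _ _ hq
  obtain ⟨w, hw⟩ := H.symm.exists_mem (frontier_subset_closure hqV)
  have hwq := H.symm.swap_mem hw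
  exact ⟨⟨w, H.mem_connectedComponentIn_of_mem hzp hwq hzU (H.symm.snd_mem_frontier hw hqV) hq⟩,
    Subtype.ext (closedGraph_eq_of_extendsContinuously h hwq).symm⟩

end IsDomainHomeo

theorem finite_setOf_lt_diam {K : Set ℂ}
    (hdiam : ∑' Q : ↥(NondegComponents K), Metric.ediam (Q : Set ℂ) < ⊤) {C : ℝ} (hC : 0 < C) :
    {Q : Set ℂ | (∃ x ∈ K, Q = connectedComponentIn K x) ∧ C < Metric.diam Q}.Finite := by
  have hfin := ENNReal.finite_const_le_of_tsum_ne_top hdiam.ne (ENNReal.ofReal_pos.2 hC).ne'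
  refine (hfin.image (↑)).subset ?_
  rintro Q ⟨hQ, hCQ⟩
  have hQn : Q ∈ NondegComponents K := by
    refine ⟨hQ, ?_⟩
    by_contra! hcon
    have : Metric.diam Q = 0 := diam_subsingleton fun a ha b hb => hcon a ha b hb
    linarith
  refine ⟨⟨Q, hQn⟩, ?_, rfl⟩
  exact ENNReal.ofReal_le_of_le_toReal hCQ.le

theorem lintegral_enorm_deriv_sq {U : Set ℂ} (hU : IsOpen U) {φ : ℂ → ℂ}
    (hφ : DifferentiableOn ℂ φ U) (hinj : InjOn φ U) :
    ∫⁻ z in U, ENNReal.ofReal (‖deriv φ z‖ ^ 2) = volume (φ '' U) := by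
  rw [← lintegral_abs_det_fderiv_eq_addHaar_image volume hU.measurableSet
    (f' := fun z => (ContinuousLinearMap.toSpanSingleton ℂ (deriv φ z)).restrictScalars ℝ)
    (fun z hz => ((hφ.differentiableAt (hU.mem_nhds hz)).hasDerivAt.hasFDerivAt.restrictScalars
      ℝ).hasFDerivWithinAt) hinj]
  refine lintegral_congr fun z => ?_
  simp [ContinuousLinearMap.det, LinearMap.det_restrictScalars, Algebra.norm_complex_eq,
    Complex.normSq_eq_norm_sq]

/-- The length of the image under `φ` of the part of a circle lying in `U`. -/
def circleImageLength (φ : ℂ → ℂ) (U : Set ℂ) (c : ℂ) (r : ℝ) : ℝ≥0∞ :=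
  ∫⁻ θ in Ioo (-Real.pi) Real.pi,
    U.indicator (fun z => ENNReal.ofReal (r * ‖deriv φ z‖)) (circleMap c r θ)

theorem lintegral_circle_ne_top {F : ℂ → ℝ≥0∞} (hF : Measurable F) (hFi : ∫⁻ z, F z ≠ ⊤) (c : ℂ) :
    ∫⁻ r in Ioi (0 : ℝ), ∫⁻ θ in Ioo (-Real.pi) Real.pi,
      ENNReal.ofReal r * F (circleMap c r θ) ≠ ⊤ := by
  have h1 : ∫⁻ z, F (c + z) = ∫⁻ z, F z := lintegral_add_left_eq_self F c
  rw [← h1, ← Complex.lintegral_comp_polarCoord_symm] at hFi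
  convert hFi using 1
  rw [polarCoord_target, Measure.volume_eq_prod, setLIntegral_prod]
  · refine lintegral_congr fun r => lintegral_congr fun θ => ?_
    simp [circleMap, Complex.exp_mul_I]
  · simp only [Complex.polarCoord_symm_apply]
    fun_prop

theorem lintegral_inv_Ioo_eq_top {R k : ℝ} (hR : 0 < R) (hk : 0 < k) :
    ∫⁻ r in Ioo 0 R, ENNReal.ofReal (k / r) = ⊤ := by
  by_contra h
  have h1 : IntegrableOn (fun r : ℝ => k / r) (Ioo 0 R) := by
    refine ⟨by fun_prop, ?_⟩
    rw [hasFiniteIntegral_iff_ofReal]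
    · exact lt_top_iff_ne_top.2 h
    · filter_upwards [ae_restrict_mem measurableSet_Ioo] with r hr
      exact div_nonneg hk.le hr.1.le
  have h2 : IntegrableOn (fun r : ℝ => r⁻¹) (Ioo 0 R) := by
    refine (h1.const_mul k⁻¹).congr (.of_forall fun r => ?_)
    simp only
    field_simp
  rw [← intervalIntegrable_iff_integrableOn_Ioo_of_le hR.le, intervalIntegrable_inv_iff] at h2
  rcases h2 with h2 | h2
  · exact hR.ne h2
  · exact h2 left_mem_uIcc

/-- The length-area principle. -/
theorem not_ae_le_circleImageLength {U : Set ℂ} (hU : IsOpen U) {φ : ℂ → ℂ}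
    (hφ : DifferentiableOn ℂ φ U) (hinj : InjOn φ U) (hfin : volume (φ '' U) ≠ ⊤) (c : ℂ)
    {R ε : ℝ} (hR : 0 < R) (hε : 0 < ε) :
    ¬ ∀ᵐ r ∂volume.restrict (Ioo 0 R), ENNReal.ofReal ε ≤ circleImageLength φ U c r := by
  intro hae
  set F : ℂ → ℝ≥0∞ := U.indicator fun z => ENNReal.ofReal (‖deriv φ z‖ ^ 2) with hF
  have hFm : Measurable F := by
    refine Measurable.indicator ?_ hU.measurableSet
    have := measurable_deriv φ
    fun_prop
  have hFi : ∫⁻ z, F z ≠ ⊤ := by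
    rw [hF, lintegral_indicator hU.measurableSet, lintegral_enorm_deriv_sq hU hφ hinj]
    exact hfin
  refine lintegral_circle_ne_top hFm hFi c ?_
  set lam : ℝ := ε / (2 * Real.pi) with hlam
  have hlam0 : 0 < lam := div_pos hε Real.two_pi_pos
  rw [eq_top_iff, ← lintegral_inv_Ioo_eq_top hR (mul_pos hlam0 hε)]
  refine le_trans ?_ (lintegral_mono_set (Ioo_subset_Ioi_self : Ioo 0 R ⊆ _))
  refine lintegral_mono_ae ?_
  filter_upwards [hae, ae_restrict_mem measurableSet_Ioo] with r hr hr0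
  have hr0 := hr0.1
  have key : ENNReal.ofReal (2 * lam) * circleImageLength φ U c r ≤
      ENNReal.ofReal (lam * ε) + ENNReal.ofReal r *
        ∫⁻ θ in Ioo (-Real.pi) Real.pi, ENNReal.ofReal r * F (circleMap c r θ) := by
    have hm : Measurable fun θ => ENNReal.ofReal r * (ENNReal.ofReal r * F (circleMap c r θ)) := by
      have := hFm.comp (continuous_circleMap c r).measurable
      fun_prop
    have hconst : ENNReal.ofReal (lam * ε) =
        ∫⁻ _ in Ioo (-Real.pi) Real.pi, ENNReal.ofReal (lam ^ 2) := by
      rw [setLIntegral_const, Real.volume_Ioo, ← ENNReal.ofReal_mul (by positivity)]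
      congr 1
      rw [hlam]
      field_simp
      ring
    rw [circleImageLength, ← lintegral_const_mul' _ _ ENNReal.ofReal_ne_top,
      ← lintegral_const_mul' _ _ ENNReal.ofReal_ne_top, hconst,
      ← lintegral_add_left measurable_const]
    refine lintegral_mono fun θ => ?_
    by_cases hθ : circleMap c r θ ∈ U
    · simp only [hF, indicator_of_mem hθ]
      rw [← ENNReal.ofReal_mul (by positivity), ← ENNReal.ofReal_mul hr0.le,
        ← ENNReal.ofReal_mul hr0.le, ← ENNReal.ofReal_add (by positivity) (by positivity)]
      refine ENNReal.ofReal_le_ofReal ?_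
      nlinarith [sq_nonneg (lam - r * ‖deriv φ (circleMap c r θ)‖)]
    · simp [hF, indicator_of_notMem hθ]
  have h2 : ENNReal.ofReal (lam * ε) + ENNReal.ofReal (lam * ε) ≤ ENNReal.ofReal (lam * ε) +
      ENNReal.ofReal r *
        ∫⁻ θ in Ioo (-Real.pi) Real.pi, ENNReal.ofReal r * F (circleMap c r θ) := by
    refine le_trans ?_ key
    rw [← ENNReal.ofReal_add (by positivity) (by positivity), ← two_mul, ← mul_assoc,
      ENNReal.ofReal_mul (by positivity)]
    gcongr
  have h3 := (ENNReal.add_le_add_iff_left ENNReal.ofReal_ne_top).1 h2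
  rw [ENNReal.ofReal_div_of_pos hr0]
  exact ENNReal.div_le_of_le_mul' h3

/-- The image of a circle under a one-dimensional projection of `φ` is at most as long as the
image of the circle. -/
theorem volume_image_circle_le {U : Set ℂ} (hU : IsOpen U) {φ : ℂ → ℂ}
    (hφ : DifferentiableOn ℂ φ U) (f : ℂ →L[ℝ] ℝ) (hf : ∀ w, |f w| ≤ ‖w‖) (c : ℂ) {r : ℝ}
    (hr : 0 < r) :
    volume ((fun z => f (φ z)) '' (U ∩ sphere c r)) ≤ circleImageLength φ U c r := by
  set S : Set ℝ := Ioc (-Real.pi) Real.pi ∩ circleMap c r ⁻¹' U with hS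
  have hSm : MeasurableSet S :=
    measurableSet_Ioc.inter ((continuous_circleMap c r).measurable hU.measurableSet)
  have himg : (fun z => f (φ z)) '' (U ∩ sphere c r) =
      (fun θ => f (φ (circleMap c r θ))) '' S := by
    ext t
    constructor
    · rintro ⟨z, ⟨hzU, hz⟩, rfl⟩
      rw [← abs_of_pos hr, ← range_circleMap,
        ← (periodic_circleMap c r).image_Ioc Real.two_pi_pos (-Real.pi)] at hz
      obtain ⟨θ, hθ, rfl⟩ := hz
      exact ⟨θ, ⟨⟨hθ.1, by linarith [hθ.2]⟩, hzU⟩, rfl⟩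
    · rintro ⟨θ, hθ, rfl⟩
      exact ⟨_, ⟨hθ.2, circleMap_mem_sphere c hr.le θ⟩, rfl⟩
  have hder : ∀ θ ∈ S, HasDerivWithinAt (fun θ => f (φ (circleMap c r θ)))
      (f (deriv (circleMap c r) θ • deriv φ (circleMap c r θ))) S θ := by
    intro θ hθ
    have h1 := (hφ.differentiableAt (hU.mem_nhds hθ.2)).hasDerivAt
    have h2 := (differentiable_circleMap c r θ).hasDerivAt
    exact (f.hasFDerivAt.comp_hasDerivAt θ (h1.scomp θ h2)).hasDerivWithinAt
  rw [himg]
  refine (addHaar_image_le_lintegral_abs_det_fderiv volume hSm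
    fun θ hθ => (hder θ hθ).hasFDerivWithinAt).trans ?_
  rw [circleImageLength, restrict_Ioo_eq_restrict_Ioc, hS, inter_comm,
    ← Measure.restrict_restrict ((continuous_circleMap c r).measurable hU.measurableSet)]
  rw [← lintegral_indicator ((continuous_circleMap c r).measurable hU.measurableSet)]
  refine lintegral_mono fun θ => ?_
  by_cases hθ : circleMap c r θ ∈ U
  · rw [indicator_of_mem (show θ ∈ circleMap c r ⁻¹' U from hθ), indicator_of_mem hθ]
    refine ENNReal.ofReal_le_ofReal ?_
    rw [ContinuousLinearMap.det_toSpanSingleton]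
    refine (hf _).trans ?_
    rw [norm_smul, deriv_circleMap]
    simp [abs_of_pos hr]
  · rw [indicator_of_notMem (show θ ∉ circleMap c r ⁻¹' U from hθ)]
    exact zero_le

theorem countable_setOf_hausdorffMeasure_ne_zero {X : Set ℂ} (hX : SigmaFiniteH1 X) {ι : Type*}
    {T : ι → Set ℂ} (hm : ∀ i, MeasurableSet (T i)) (hd : Pairwise (Function.onFun Disjoint T))
    (hsub : ∀ i, T i ⊆ X) : {i | μH[1] (T i) ≠ 0}.Countable := by
  obtain ⟨f, rfl, hf⟩ := hX
  refine (countable_iUnion fun n => Measure.countable_meas_pos_of_disjoint_of_meas_iUnion_ne_top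
    ((μH[1] : Measure ℂ).restrict (f n)) hm hd ?_).mono ?_
  · refine ne_top_of_le_ne_top (hf n).ne ?_
    exact (measure_mono (subset_univ _)).trans (Measure.restrict_apply_univ _).le
  · intro i hi
    by_contra hcon
    simp only [mem_iUnion, mem_ofPred_eq, not_exists, not_lt, nonpos_iff_eq_zero] at hcon
    refine hi (measure_mono_null (t := ⋃ n, T i ∩ f n) ?_ (measure_iUnion_null fun n => ?_))
    · rw [← inter_iUnion]
      exact subset_inter subset_rfl (hsub i)
    · rw [← Measure.restrict_apply (hm i)]
      exact hcon n

theorem singletonPart_eq_diff (K : Set ℂ) : SingletonPart K = K \ ⋃₀ NondegComponents K := by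
  ext x
  constructor
  · rintro ⟨hx, hx1⟩
    refine ⟨hx, ?_⟩
    rintro ⟨_, ⟨⟨y, hy, rfl⟩, a, ha, b, hb, hab⟩, hxy⟩
    rw [connectedComponentIn_eq hxy, hx1] at ha hb
    exact hab (ha.trans hb.symm)
  · rintro ⟨hx, hx1⟩
    refine ⟨hx, ?_⟩
    by_contra hcon
    refine hx1 ⟨_, ⟨⟨x, hx, rfl⟩, ?_⟩, mem_connectedComponentIn hx⟩
    by_contra! hab
    exact hcon (Subset.antisymm (fun y hy => hab _ hy _ (mem_connectedComponentIn hx))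
      (singleton_subset_iff.2 (mem_connectedComponentIn hx)))

theorem isClosed_of_mem_nondegComponents {K : Set ℂ} (hK : IsClosed K) {P : Set ℂ}
    (hP : P ∈ NondegComponents K) : IsClosed P := by
  obtain ⟨⟨x, -, rfl⟩, -⟩ := hP
  exact isClosed_connectedComponentIn_of_isClosed hK x

theorem measurableSet_singletonPart {K : Set ℂ} (hK : IsClosed K)
    (hc : (NondegComponents K).Countable) : MeasurableSet (SingletonPart K) := by
  rw [singletonPart_eq_diff]
  exact hK.measurableSet.diff (MeasurableSet.sUnion hc fun P hP =>
    (isClosed_of_mem_nondegComponents hK hP).measurableSet)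

theorem IsPeanoCompactum.countable_nondegComponents {K : Set ℂ} (hK : IsPeanoCompactum K) :
    (NondegComponents K).Countable := by
  refine (countable_iUnion fun n : ℕ =>
    (hK.2.2 (1 / ((n : ℝ) + 1)) Nat.one_div_pos_of_nat).countable).mono ?_
  rintro Q ⟨⟨x, hx, rfl⟩, a, ha, b, hb, hab⟩
  have hbd : Bornology.IsBounded (connectedComponentIn K x) :=
    hK.1.isBounded.subset (connectedComponentIn_subset _ _)
  obtain ⟨n, hn⟩ := exists_nat_one_div_lt
    ((dist_pos.2 hab).trans_le (dist_le_diam_of_mem hbd ha hb))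
  exact mem_iUnion.2 ⟨n, ⟨x, hx, rfl⟩, hn⟩

namespace IsDomainHomeo

variable {φ ψ : ℂ → ℂ} {U V : Set ℂ}

theorem countable_setOf_singleton_image_ne_zero (H : IsDomainHomeo φ ψ U V)
    (hU : (NondegComponents (frontier U)).Countable)
    (hV : (NondegComponents (frontier V)).Countable)
    (hs : SigmaFiniteH1 (SingletonPart (frontier V))) (c : ℂ) :
    {r : ℝ | μH[1] (SingletonPart (frontier V) ∩
      {p | ∃ z ∈ sphere c r ∩ frontier U, (z, p) ∈ closedGraph φ U}) ≠ 0}.Countable := by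
  set N : Set ℂ := {p | p ∈ SingletonPart (frontier V) ∧ ∃ z ∈ frontier U, ∃ z' ∈ frontier U,
    z ≠ z' ∧ (z, p) ∈ closedGraph φ U ∧ (z', p) ∈ closedGraph φ U} with hN
  have hNc : N.Countable := by
    have hch : ∀ p ∈ N, ∃ z ∈ frontier U, (z, p) ∈ closedGraph φ U ∧
        connectedComponentIn (frontier U) z ∈ NondegComponents (frontier U) := by
      rintro p ⟨hp, z, hz, z', hz', hne, h, h'⟩
      exact ⟨z, hz, h, ⟨z, hz, rfl⟩, z, mem_connectedComponentIn hz, z',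
        H.mem_connectedComponentIn_of_mem h h' hz hz' (mem_connectedComponentIn hp.1), hne⟩
    choose! g hgU hgG hgN using hch
    refine MapsTo.countable_of_injOn (f := fun p => connectedComponentIn (frontier U) (g p))
      (t := NondegComponents (frontier U)) (fun p hp => hgN p hp) ?_ hU
    intro p hp q hq hpq
    have hmem : g q ∈ connectedComponentIn (frontier U) (g p) := by
      dsimp only at hpq
      rw [hpq]
      exact mem_connectedComponentIn (hgU q hq)
    have := (H.mem_connectedComponentIn_iff (hgG p hp) (hgG q hq) (hgU p hp) (hgU q hq)).2 hmem
    rw [hp.1.2] at this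
    exact this.symm
  have hcount := countable_setOf_hausdorffMeasure_ne_zero hs
    (T := fun r : ℝ => (SingletonPart (frontier V) ∩
      {p | ∃ z ∈ sphere c r ∩ frontier U, (z, p) ∈ closedGraph φ U}) \ N) (fun r =>
        ((measurableSet_singletonPart isClosed_frontier hV).inter
          (H.isCompact_image (isClosed_sphere.inter isClosed_frontier)).isClosed.measurableSet).diff
          hNc.measurableSet) (fun r r' hr => disjoint_left.2 ?_)
    (fun r => sdiff_subset.trans inter_subset_left)
  · refine hcount.mono fun r hr => fun h0 => hr ?_
    refine measure_mono_null (subset_sdiff_union _ N) (measure_union_null h0 ?_)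
    have : NullSingletonClass (μH[1] : Measure ℂ) := Measure.nullSingletonClass_hausdorff ℂ one_pos
    exact hNc.measure_zero _
  · rintro p ⟨⟨hp, z, hz, h⟩, hpN⟩ ⟨⟨-, z', hz', h'⟩, -⟩
    refine hpN ⟨hp, z, hz.2, z', hz'.2, ?_, h, h'⟩
    rintro rfl
    exact hr ((mem_sphere.1 hz.1).symm.trans (mem_sphere.1 hz'.1))

/-- There are arbitrarily small circles whose image, including the boundary components touched, is
small. -/
theorem exists_radius (H : IsDomainHomeo φ ψ U V) (hφ : DifferentiableOn ℂ φ U)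
    (hU : (NondegComponents (frontier U)).Countable)
    (hV : (NondegComponents (frontier V)).Countable)
    (hdiam : ∑' Q : ↥(NondegComponents (frontier V)), Metric.ediam (Q : Set ℂ) ≠ ⊤)
    (hs : SigmaFiniteH1 (SingletonPart (frontier V))) {z₀ p₀ : ℂ} (hz₀ : z₀ ∈ frontier U)
    (hp₀ : (z₀, p₀) ∈ closedGraph φ U) {ε R : ℝ} (hε : 0 < ε) (hR : 0 < R) :
    ∃ r ∈ Ioo 0 R, ∃ s : Finset (NondegComponents (frontier V)),
      circleImageLength φ U z₀ r +
        ∑' P : {P // P ∉ s}, Metric.ediam ((P : NondegComponents (frontier V)) : Set ℂ) <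
          ENNReal.ofReal ε ∧
      (∀ P ∈ s, p₀ ∉ (P : Set ℂ) → ∀ z ∈ sphere z₀ r, ∀ p ∈ (P : Set ℂ),
        (z, p) ∉ closedGraph φ U) ∧
      μH[1] (SingletonPart (frontier V) ∩
        {p | ∃ z ∈ sphere z₀ r ∩ frontier U, (z, p) ∈ closedGraph φ U}) = 0 := by
  obtain ⟨s, hs1⟩ := ((ENNReal.tendsto_tsum_compl_atTop_zero hdiam).eventually
    (gt_mem_nhds (ENNReal.ofReal_pos.2 (half_pos hε)))).exists
  have hfar : ∀ P ∈ s, p₀ ∉ (P : Set ℂ) → ∀ᶠ δ in 𝓝[>] (0 : ℝ), ∀ z ∈ ball z₀ δ, ∀ p ∈ (P : Set ℂ),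
        (z, p) ∉ closedGraph φ U := by
    intro P _ hpP
    obtain ⟨⟨x, hx, hPx⟩, -⟩ := P.2
    have hcl := (H.symm.isCompact_image
      (isClosed_of_mem_nondegComponents isClosed_frontier P.2)).isClosed
    have hz : z₀ ∉ {z | ∃ p ∈ (P : Set ℂ), (p, z) ∈ closedGraph ψ V} := by
      rintro ⟨p, hp, h⟩
      refine hpP ?_
      have hpp := (H.mem_connectedComponentIn_iff (H.symm.swap_mem h) hp₀ hz₀ hz₀).2
        (mem_connectedComponentIn hz₀)
      rw [hPx] at hp ⊢
      rwa [connectedComponentIn_eq hp]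
    obtain ⟨δ, hδ, hb⟩ := Metric.isOpen_iff.1 hcl.isOpen_compl z₀ hz
    filter_upwards [Ioc_mem_nhdsGT hδ] with δ' hδ' z hz p hp h
    exact hb (ball_subset_ball hδ'.2 hz) ⟨p, hp, H.swap_mem h⟩
  have hfar2 : ∀ᶠ δ in 𝓝[>] (0 : ℝ), ∀ P ∈ s, p₀ ∉ (P : Set ℂ) → ∀ z ∈ ball z₀ δ,
      ∀ p ∈ (P : Set ℂ), (z, p) ∉ closedGraph φ U := by
    rw [Filter.eventually_all_finset]
    intro P hP
    by_cases hpP : p₀ ∈ (P : Set ℂ)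
    · exact .of_forall fun _ h => absurd hpP h
    · filter_upwards [hfar P hP hpP] with δ hδ _ using hδ
  obtain ⟨δ, hδ, hδ0⟩ := (hfar2.and self_mem_nhdsWithin).exists
  have hδ0 : 0 < δ := hδ0
  have hinj : InjOn φ U := fun z hz w hw h => by rw [← H.left_inv z hz, h, H.left_inv w hw]
  have hvol : volume (φ '' U) ≠ ⊤ :=
    ((H.isBounded_target.subset (image_subset_iff.2 H.mapsTo)).measure_lt_top).ne
  have hnae := not_ae_le_circleImageLength H.isOpen_source hφ hinj hvol z₀
    (lt_min hR hδ0) (half_pos hε)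
  have hnull : ∀ᵐ r ∂volume.restrict (Ioo 0 (min R δ)), μH[1] (SingletonPart (frontier V) ∩
        {p | ∃ z ∈ sphere z₀ r ∩ frontier U, (z, p) ∈ closedGraph φ U}) = 0 :=
    ae_restrict_of_ae ((H.countable_setOf_singleton_image_ne_zero hU hV hs z₀).measure_zero _)
  obtain ⟨r, hr, hr0, hr1⟩ := ((Filter.not_eventually.1 hnae).and_eventually
    (hnull.and (ae_restrict_mem measurableSet_Ioo))).exists
  refine ⟨r, ⟨hr1.1, hr1.2.trans_le (min_le_left _ _)⟩, s, ?_, fun P hP hpP z hz => ?_, hr0⟩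
  · rw [← add_halves ε, ENNReal.ofReal_add (half_pos hε).le (half_pos hε).le]
    exact ENNReal.add_lt_add (not_le.1 hr) hs1
  · refine hδ P hP hpP z ?_
    rw [mem_ball, mem_sphere.1 hz]
    exact hr1.2.trans_le (min_le_right _ _)

end IsDomainHomeo

namespace IsDomainHomeo

variable {φ ψ : ℂ → ℂ} {U V : Set ℂ}

/-- The image of a subset of the circle of radius `r`, saturated with respect to boundary
components. -/
def saturatedImage (φ : ℂ → ℂ) (U V J : Set ℂ) : Set ℂ :=
  {p | ∃ z ∈ J, ∃ p', (z, p') ∈ closedGraph φ U ∧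
    (p = p' ∨ p ∈ connectedComponentIn (frontier V) p')}

theorem volume_image_saturatedImage_le (H : IsDomainHomeo φ ψ U V) (hφ : DifferentiableOn ℂ φ U)
    (hV : (NondegComponents (frontier V)).Countable) {z₀ p₀ : ℂ} {r : ℝ} (hr : 0 < r)
    {s : Finset (NondegComponents (frontier V))}
    (hs : ∀ P ∈ s, p₀ ∉ (P : Set ℂ) → ∀ z ∈ sphere z₀ r, ∀ p ∈ (P : Set ℂ),
      (z, p) ∉ closedGraph φ U)
    (h0 : μH[1] (SingletonPart (frontier V) ∩
        {p | ∃ z ∈ sphere z₀ r ∩ frontier U, (z, p) ∈ closedGraph φ U}) = 0)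
    {K : Set ℂ} (hK : K ⊆ saturatedImage φ U V (sphere z₀ r))
    (hKp : Disjoint K (connectedComponentIn (frontier V) p₀))
    (f : ℂ →L[ℝ] ℝ) (hf : ∀ w, |f w| ≤ ‖w‖) :
    volume (f '' K) ≤ circleImageLength φ U z₀ r +
        ∑' P : {P // P ∉ s}, Metric.ediam ((P : NondegComponents (frontier V)) : Set ℂ) := by
  have hlip : LipschitzWith 1 f := LipschitzWith.of_dist_le_mul fun x y => by
    rw [Real.dist_eq, ← map_sub, dist_eq_norm, NNReal.coe_one, one_mul]
    exact hf _
  set S := SingletonPart (frontier V) ∩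
    {p | ∃ z ∈ sphere z₀ r ∩ frontier U, (z, p) ∈ closedGraph φ U} with hS
  have hcover : f '' K ⊆ (fun z => f (φ z)) '' (U ∩ sphere z₀ r) ∪
      (⋃ P : {P // P ∉ s}, f '' ((P : NondegComponents (frontier V)) : Set ℂ)) ∪ f '' S := by
    rintro _ ⟨p, hp, rfl⟩
    obtain ⟨z, hz, p', h, hpp⟩ := hK hp
    by_cases hzU : z ∈ U
    · left; left
      have hp' := H.snd_eq h hzU
      rcases hpp with rfl | hpp
      · exact ⟨z, ⟨hzU, hz⟩, by rw [hp']⟩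
      · rw [connectedComponentIn_eq_empty] at hpp
        · exact absurd hpp (notMem_empty _)
        · rw [H.isOpen_target.frontier_eq, hp']
          exact fun hmem => hmem.2 (H.mapsTo hzU)
    · have hzf : z ∈ frontier U := by
        rw [H.isOpen_source.frontier_eq]
        exact ⟨H.fst_mem_closure h, hzU⟩
      have hp'V := H.snd_mem_frontier h hzf
      have hpcc : p ∈ connectedComponentIn (frontier V) p' := by
        rcases hpp with rfl | hpp
        · exact mem_connectedComponentIn hp'V
        · exact hpp
      by_cases hP : connectedComponentIn (frontier V) p' ∈ NondegComponents (frontier V)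
      · left; right
        refine mem_iUnion.2 ⟨⟨⟨_, hP⟩, fun hPs => ?_⟩, p, hpcc, rfl⟩
        by_cases hp₀ : p₀ ∈ connectedComponentIn (frontier V) p'
        · refine disjoint_left.1 hKp hp ?_
          rwa [← connectedComponentIn_eq hp₀]
        · exact hs _ hPs hp₀ z hz p' (mem_connectedComponentIn hp'V) h
      · right
        have hsub : ∀ a ∈ connectedComponentIn (frontier V) p', a = p' := fun a ha => by
          by_contra hne
          exact hP ⟨⟨p', hp'V, rfl⟩, a, ha, p', mem_connectedComponentIn hp'V, hne⟩
        refine ⟨p, ⟨⟨connectedComponentIn_subset _ _ hpcc, ?_⟩, z, ⟨hz, hzf⟩, ?_⟩, rfl⟩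
        · rw [hsub p hpcc]
          exact Subset.antisymm hsub (singleton_subset_iff.2 (mem_connectedComponentIn hp'V))
        · rwa [hsub p hpcc]
  have := hV.to_subtype
  refine (measure_mono hcover).trans ?_
  refine (measure_union_le _ _).trans ?_
  have hS0 : volume (f '' S) = 0 := by
    rw [← hausdorffMeasure_real]
    refine le_antisymm ((hlip.hausdorffMeasure_image_le zero_le_one S).trans ?_) zero_le
    rw [h0, mul_zero]
  rw [hS0, add_zero]
  refine (measure_union_le _ _).trans (add_le_add
    (volume_image_circle_le H.isOpen_source hφ f hf z₀ hr) ?_)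
  refine (measure_iUnion_le _).trans (ENNReal.tsum_le_tsum fun P => ?_)
  refine (Real.volume_le_diam _).trans ?_
  simpa using hlip.ediam_image_le ((P : NondegComponents (frontier V)) : Set ℂ)

/-- There are arbitrarily small circles such that every connected subset of the saturated image of
the circle, missing the boundary component of the centre, is small. -/
theorem exists_radius_dist_le (H : IsDomainHomeo φ ψ U V) (hφ : DifferentiableOn ℂ φ U)
    (hU : (NondegComponents (frontier U)).Countable)
    (hV : (NondegComponents (frontier V)).Countable)
    (hdiam : ∑' Q : ↥(NondegComponents (frontier V)), Metric.ediam (Q : Set ℂ) ≠ ⊤)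
    (hs : SigmaFiniteH1 (SingletonPart (frontier V))) {z₀ p₀ : ℂ} (hz₀ : z₀ ∈ frontier U)
    (hp₀ : (z₀, p₀) ∈ closedGraph φ U) {ε R : ℝ} (hε : 0 < ε) (hR : 0 < R) :
    ∃ r ∈ Ioo 0 R, ∀ K ⊆ saturatedImage φ U V (sphere z₀ r), IsPreconnected K →
      Disjoint K (connectedComponentIn (frontier V) p₀) → ∀ p ∈ K, ∀ q ∈ K, dist p q ≤ ε := by
  obtain ⟨r, hr, s, hlt, hfar, h0⟩ :=
    H.exists_radius hφ hU hV hdiam hs hz₀ hp₀ (half_pos hε) hR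
  refine ⟨r, hr, fun K hK hKc hKp p hp q hq => ?_⟩
  have key : ∀ f : ℂ →L[ℝ] ℝ, (∀ w, |f w| ≤ ‖w‖) → |f p - f q| < ε / 2 := by
    intro f hf
    have h1 := (hKc.image f f.continuous.continuousOn).ordConnected.uIcc_subset
      (mem_image_of_mem f hq) (mem_image_of_mem f hp)
    have h2 := (measure_mono h1).trans_lt
      ((H.volume_image_saturatedImage_le hφ hV hr.1 hfar h0 hK hKp f hf).trans_lt hlt)
    rw [Real.volume_interval] at h2
    exact (ENNReal.ofReal_lt_ofReal_iff (half_pos hε)).1 h2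
  have hre := key Complex.reCLM Complex.abs_re_le_norm
  have him := key Complex.imCLM Complex.abs_im_le_norm
  rw [dist_eq_norm]
  refine (Complex.norm_le_abs_re_add_abs_im _).trans ?_
  simp only [Complex.reCLM_apply, Complex.imCLM_apply] at hre him
  rw [Complex.sub_re, Complex.sub_im]
  linarith

end IsDomainHomeo

theorem isClosed_setOf_mem_connectedComponentIn {K C : Set ℂ} (hK : IsCompact K)
    (hC : IsClosed C) : IsClosed {p | ∃ x ∈ C, p ∈ connectedComponentIn K x} := by
  have : CompactSpace K := isCompact_iff_compactSpace.1 hK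
  have h : {p | ∃ x ∈ C, p ∈ connectedComponentIn K x} =
      (↑) '' (((↑) : K → ConnectedComponents K) ⁻¹'
        (((↑) : K → ConnectedComponents K) '' ((↑) ⁻¹' C))) := by
    ext p
    constructor
    · rintro ⟨x, hx, hp⟩
      have hxK : x ∈ K := connectedComponentIn_nonempty_iff.1 ⟨p, hp⟩
      rw [connectedComponentIn_eq_image hxK] at hp
      obtain ⟨q, hq, rfl⟩ := hp
      exact ⟨q, ⟨⟨x, hxK⟩, hx, ConnectedComponents.coe_eq_coe.2
        (connectedComponent_eq hq)⟩, rfl⟩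
    · rintro ⟨q, ⟨x, hx, hxq⟩, rfl⟩
      refine ⟨x, hx, ?_⟩
      rw [connectedComponentIn_eq_image x.2]
      refine ⟨q, ?_, rfl⟩
      rw [ConnectedComponents.coe_eq_coe.1 hxq]
      exact mem_connectedComponent
  rw [h]
  refine hK.isClosed.isClosedEmbedding_subtypeVal.isClosedMap _ (IsClosed.preimage
    ConnectedComponents.continuous_coe ?_)
  exact ((hC.preimage continuous_subtype_val).isCompact.image
    ConnectedComponents.continuous_coe).isClosed

namespace IsDomainHomeo

variable {φ ψ : ℂ → ℂ} {U V : Set ℂ}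

theorem notMem_frontier_of_mem (H : IsDomainHomeo φ ψ U V) {z : ℂ} (hz : z ∈ U) :
    z ∉ frontier U := by
  rw [H.isOpen_source.frontier_eq]
  exact fun h => h.2 hz

theorem mem_frontier_of_notMem (H : IsDomainHomeo φ ψ U V) {z : ℂ} (hz : z ∈ closure U)
    (hzU : z ∉ U) : z ∈ frontier U := by
  rw [H.isOpen_source.frontier_eq]
  exact ⟨hz, hzU⟩

theorem saturatedImage_mono {J J' : Set ℂ} (h : J ⊆ J') :
    saturatedImage φ U V J ⊆ saturatedImage φ U V J' :=
  fun _ ⟨z, hz, hp⟩ => ⟨z, h hz, hp⟩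

theorem saturatedImage_singleton_of_mem (H : IsDomainHomeo φ ψ U V) {z : ℂ} (hz : z ∈ U) :
    saturatedImage φ U V {z} = {φ z} := by
  ext p
  constructor
  · rintro ⟨_, rfl, p', h, hp⟩
    rw [H.snd_eq h hz] at hp
    rcases hp with hp | hp
    · exact hp
    · rw [connectedComponentIn_eq_empty (H.symm.notMem_frontier_of_mem (H.mapsTo hz))] at hp
      exact absurd hp (notMem_empty _)
  · rintro rfl
    exact ⟨z, rfl, _, mk_mem z hz, Or.inl rfl⟩

theorem saturatedImage_singleton_of_frontier (H : IsDomainHomeo φ ψ U V) {z p : ℂ}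
    (hz : z ∈ frontier U) (h : (z, p) ∈ closedGraph φ U) :
    saturatedImage φ U V {z} = connectedComponentIn (frontier V) p := by
  have hmem : ∀ p', (z, p') ∈ closedGraph φ U → p' ∈ connectedComponentIn (frontier V) p :=
    fun p' h' => (H.mem_connectedComponentIn_iff h h' hz hz).2 (mem_connectedComponentIn hz)
  ext q
  constructor
  · rintro ⟨_, rfl, p', h', hq⟩
    rcases hq with rfl | hq
    · exact hmem _ h'
    · rwa [connectedComponentIn_eq (hmem _ h')]
  · intro hq
    exact ⟨z, rfl, p, h, Or.inr hq⟩

theorem isPreconnected_saturatedImage_singleton (H : IsDomainHomeo φ ψ U V) {z : ℂ}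
    (hz : z ∈ closure U) : IsPreconnected (saturatedImage φ U V {z}) := by
  by_cases hzU : z ∈ U
  · rw [H.saturatedImage_singleton_of_mem hzU]
    exact isPreconnected_singleton
  · obtain ⟨p, hp⟩ := H.exists_mem hz
    rw [H.saturatedImage_singleton_of_frontier (H.mem_frontier_of_notMem hz hzU) hp]
    exact isPreconnected_connectedComponentIn

/-- The set of points whose image lies in an open set is relatively open. -/
theorem isOpen_setOf_image_subset (H : IsDomainHomeo φ ψ U V) {O : Set ℂ} (hO : IsOpen O) :
    IsOpen {z | ∀ p, (z, p) ∈ closedGraph φ U → p ∈ O} := by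
  have := (H.symm.isCompact_image hO.isClosed_compl).isClosed.isOpen_compl
  convert this using 1
  ext z
  constructor
  · rintro h ⟨p, hp, hpz⟩
    exact hp (h p (H.symm.swap_mem hpz))
  · intro h p hp
    by_contra hpO
    exact h ⟨p, hpO, H.swap_mem hp⟩

theorem isPreconnected_saturatedImage (H : IsDomainHomeo φ ψ U V) {c : ℝ → ℂ} (hc : Continuous c)
    {I : Set ℝ} (hI : I.OrdConnected) : IsPreconnected (saturatedImage φ U V (c '' I)) := by
  set F : Set ℝ := c ⁻¹' closure U with hF
  have hFc : IsClosed F := isClosed_closure.preimage hc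
  rw [isPreconnected_iff_subset_of_disjoint]
  intro u v hu hv huv hd
  have hsub : ∀ t ∈ I, saturatedImage φ U V {c t} ⊆ saturatedImage φ U V (c '' I) := fun t ht =>
    saturatedImage_mono (singleton_subset_iff.2 ⟨t, ht, rfl⟩)
  have hor : ∀ t ∈ I ∩ F, saturatedImage φ U V {c t} ⊆ u ∨ saturatedImage φ U V {c t} ⊆ v :=
    fun t ht => (isPreconnected_iff_subset_of_disjoint.1
      (H.isPreconnected_saturatedImage_singleton ht.2)) u v hu hv ((hsub t ht.1).trans huv)
      (subset_empty_iff.1 ((inter_subset_inter_left _ (hsub t ht.1)).trans hd.subset))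
  have hnot : ∀ t ∈ I, ∀ p ∈ saturatedImage φ U V {c t}, p ∈ u → p ∉ v := fun t ht p hp hpu hpv =>
    notMem_empty p (hd ▸ (⟨hsub t ht hp, hpu, hpv⟩ : p ∈ _ ∩ (u ∩ v)))
  have hmemsat : ∀ z p, (z, p) ∈ closedGraph φ U → p ∈ saturatedImage φ U V {z} :=
    fun z p h => ⟨z, rfl, p, h, Or.inl rfl⟩
  have hconst : ∀ a ∈ I ∩ F, ∀ b ∈ I ∩ F,
      (saturatedImage φ U V {c a} ⊆ u) = (saturatedImage φ U V {c b} ⊆ u) := by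
    intro a ha b hb
    refine eq_of_locally_constant_of_gaps (χ := fun t => saturatedImage φ U V {c t} ⊆ u) hI hFc
      ?_ ?_ ha hb
    · intro t ht
      rcases hor t ht with h | h
      · have h1 : ∀ᶠ s in 𝓝 t, ∀ p, (c s, p) ∈ closedGraph φ U → p ∈ u :=
          hc.continuousAt.eventually ((H.isOpen_setOf_image_subset hu).mem_nhds
            fun p hp => h (hmemsat _ _ hp))
        filter_upwards [mem_nhdsWithin_of_mem_nhds h1, self_mem_nhdsWithin] with s hs hsI
        refine propext (iff_of_true ?_ h)
        obtain ⟨p, hp⟩ := H.exists_mem hsI.2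
        exact (hor s hsI).resolve_right fun hsv =>
          hnot s hsI.1 p (hmemsat _ _ hp) (hs p hp) (hsv (hmemsat _ _ hp))
      · have h1 : ∀ᶠ s in 𝓝 t, ∀ p, (c s, p) ∈ closedGraph φ U → p ∈ v :=
          hc.continuousAt.eventually ((H.isOpen_setOf_image_subset hv).mem_nhds
            fun p hp => h (hmemsat _ _ hp))
        obtain ⟨q, hq⟩ := H.exists_mem ht.2
        filter_upwards [mem_nhdsWithin_of_mem_nhds h1, self_mem_nhdsWithin] with s hs hsI
        refine propext (iff_of_false (fun hsu => ?_) fun htu => ?_)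
        · obtain ⟨p, hp⟩ := H.exists_mem hsI.2
          exact hnot s hsI.1 p (hmemsat _ _ hp) (hsu (hmemsat _ _ hp)) (hs p hp)
        · exact hnot t ht.1 q (hmemsat _ _ hq) (htu (hmemsat _ _ hq)) (h (hmemsat _ _ hq))
    · intro s hs t ht hst hgap
      have hU : Disjoint (c '' Icc s t) U := by
        rw [disjoint_left]
        rintro _ ⟨x, hx, rfl⟩ hxU
        have hcl : x ∈ closure (Ioo s t) := by rwa [closure_Ioo hst.ne]
        obtain ⟨x', hx'U, hx'⟩ := mem_closure_iff.1 hcl _ (H.isOpen_source.preimage hc) hxU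
        exact hgap x' hx' (subset_closure hx'U)
      have hsm : c s ∈ c '' Icc s t := ⟨s, left_mem_Icc.2 hst.le, rfl⟩
      have htm : c t ∈ c '' Icc s t := ⟨t, right_mem_Icc.2 hst.le, rfl⟩
      have hsf := H.mem_frontier_of_notMem hs.2 (disjoint_left.1 hU hsm)
      have htf := H.mem_frontier_of_notMem ht.2 (disjoint_left.1 hU htm)
      have hcc := H.mem_connectedComponentIn_of_isPreconnected
        (isPreconnected_Icc.image c hc.continuousOn) hU hsm htm hsf htf
      obtain ⟨p, hp⟩ := H.exists_mem hs.2
      obtain ⟨q, hq⟩ := H.exists_mem ht.2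
      rw [H.saturatedImage_singleton_of_frontier hsf hp,
        H.saturatedImage_singleton_of_frontier htf hq,
        connectedComponentIn_eq ((H.mem_connectedComponentIn_iff hp hq hsf htf).2 hcc)]
  have hIF : ∀ p ∈ saturatedImage φ U V (c '' I), ∃ t ∈ I ∩ F, p ∈ saturatedImage φ U V {c t} := by
    rintro p ⟨_, ⟨t, ht, rfl⟩, p', h, hp⟩
    exact ⟨t, ⟨ht, H.fst_mem_closure h⟩, c t, rfl, p', h, hp⟩
  by_cases hex : ∃ a ∈ I ∩ F, saturatedImage φ U V {c a} ⊆ u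
  · obtain ⟨a, ha, hau⟩ := hex
    left
    intro p hp
    obtain ⟨t, ht, hpt⟩ := hIF p hp
    exact (hconst a ha t ht).mp hau hpt
  · right
    intro p hp
    obtain ⟨t, ht, hpt⟩ := hIF p hp
    exact (hor t ht).resolve_left (fun h => hex ⟨t, ht, h⟩) hpt

theorem isClosed_saturatedImage (H : IsDomainHomeo φ ψ U V) {J : Set ℂ} (hJ : IsClosed J) :
    IsClosed (saturatedImage φ U V J) := by
  have h1 := (H.isCompact_image hJ).isClosed
  have h2 := isClosed_setOf_mem_connectedComponentIn H.symm.isCompact_frontier h1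
  convert h1.union h2 using 1
  ext p
  constructor
  · rintro ⟨z, hz, p', h, rfl | hp⟩
    · exact Or.inl ⟨z, hz, h⟩
    · exact Or.inr ⟨p', ⟨z, hz, h⟩, hp⟩
  · rintro (⟨z, hz, h⟩ | ⟨p', ⟨z, hz, h⟩, hp⟩)
    · exact ⟨z, hz, p, h, Or.inl rfl⟩
    · exact ⟨z, hz, p', h, Or.inr hp⟩

theorem closure_saturatedImage_subset (H : IsDomainHomeo φ ψ U V) {J : Set ℂ} {z₀ p₀ : ℂ}
    (hz₀ : z₀ ∈ frontier U) (hp₀ : (z₀, p₀) ∈ closedGraph φ U)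
    (hJ : IsClosed (connectedComponentIn (frontier U) z₀ ∪ J)) :
    closure (saturatedImage φ U V J) ⊆
      saturatedImage φ U V J ∪ connectedComponentIn (frontier V) p₀ := by
  refine (closure_minimal (saturatedImage_mono subset_union_right)
    (H.isClosed_saturatedImage hJ)).trans ?_
  rintro p ⟨z, hz | hz, hp⟩
  · right
    obtain ⟨p', h, -⟩ := id hp
    have hzU := connectedComponentIn_subset _ _ hz
    rw [connectedComponentIn_eq ((H.mem_connectedComponentIn_iff hp₀ h hz₀ hzU).2 hz),
      ← H.saturatedImage_singleton_of_frontier hzU h]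
    exact ⟨z, rfl, hp⟩
  · exact Or.inl ⟨z, hz, hp⟩

theorem connectedComponentIn_subset_saturatedImage {J : Set ℂ} {p : ℂ}
    (hp : p ∈ saturatedImage φ U V J) :
    connectedComponentIn (frontier V) p ⊆ saturatedImage φ U V J := by
  obtain ⟨z, hz, p', h, rfl | hp'⟩ := hp
  · exact fun q hq => ⟨z, hz, p, h, Or.inr hq⟩
  · rw [← connectedComponentIn_eq hp']
    exact fun q hq => ⟨z, hz, p', h, Or.inr hq⟩

theorem disjoint_saturatedImage (H : IsDomainHomeo φ ψ U V) {J : Set ℂ} {z₀ p₀ : ℂ}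
    (hz₀ : z₀ ∈ frontier U) (hp₀ : (z₀, p₀) ∈ closedGraph φ U)
    (hJ : Disjoint J (connectedComponentIn (frontier U) z₀)) :
    Disjoint (saturatedImage φ U V J) (connectedComponentIn (frontier V) p₀) := by
  rw [disjoint_left]
  rintro p hp hp0
  have hpV := connectedComponentIn_subset _ _ hp0
  obtain ⟨z, hz, p', h, hpp⟩ := hp
  have hp' : p' ∈ connectedComponentIn (frontier V) p₀ := by
    rcases hpp with rfl | hpp
    · exact hp0
    · have hp'V : p' ∈ frontier V := connectedComponentIn_nonempty_iff.1 ⟨p, hpp⟩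
      rw [connectedComponentIn_eq hp0, ← connectedComponentIn_eq hpp]
      exact mem_connectedComponentIn hp'V
  have hzU : z ∈ frontier U :=
    H.symm.snd_mem_frontier (H.swap_mem h) (connectedComponentIn_subset _ _ hp')
  exact disjoint_left.1 hJ hz ((H.mem_connectedComponentIn_iff hp₀ h hz₀ hzU).1 hp')

end IsDomainHomeo

/-- Around a point `z₀` of a point or Jordan curve `Q`, points near `z₀` which lie on the same side
of `Q` are simultaneously separated from far away points by adding an arc of a circle to `Q`. -/
theorem exists_arc_not_hasRatioLog_pair {Q : Set ℂ} {z₀ : ℂ} (hQc : IsCompact Q)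
    (hQp : IsPreconnected Q) (hz₀ : z₀ ∈ Q) (hQ : Q = {z₀} ∨ IsJordanCurve Q) {r : ℝ} (hr : 0 < r) :
    ∃ δ > 0, ∀ z ∈ ball z₀ δ, ∀ z' ∈ ball z₀ δ, z' ∉ Q → HasRatioLog Q z z' →
      ∀ y ∉ closedBall z₀ r, y ∉ Q → ∃ I : Set ℝ, I.OrdConnected ∧
        (∀ θ ∈ I, circleMap z₀ r θ ∉ Q) ∧ IsClosed (Q ∪ circleMap z₀ r '' I) ∧
        ¬HasRatioLog (Q ∪ circleMap z₀ r '' I) z y ∧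
        ¬HasRatioLog (Q ∪ circleMap z₀ r '' I) z' y := by
  obtain ⟨β, hβQ, hβc, hβp, hzβ, hβ⟩ := exists_arc_compl_subset_ball hz₀ hQ hr
  have hcpt : IsCompact (β ∪ sphere z₀ r) := hβc.union (isCompact_sphere z₀ r)
  have hnot : z₀ ∉ β ∪ sphere z₀ r := by
    rintro (h | h)
    · exact hzβ h
    · rw [mem_sphere, dist_self] at h
      exact hr.ne h
  obtain ⟨δ₀, hδ₀, hδ₀s⟩ := Metric.isOpen_iff.1 hcpt.isClosed.isOpen_compl z₀ hnot
  refine ⟨min δ₀ r, lt_min hδ₀ hr, fun z hz z' hz' hz'Q hzz' y hy hyQ => ?_⟩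
  have hB : HasRatioLog (β ∪ sphere z₀ r) z z' :=
    HasRatioLog.of_isPreconnected hcpt.isClosed (convex_ball z₀ δ₀).isPreconnected
      (subset_compl_iff_disjoint_right.1 hδ₀s) (ball_subset_ball (min_le_left _ _) hz)
      (ball_subset_ball (min_le_left _ _) hz')
  have hU : HasRatioLog (Q ∪ (β ∪ sphere z₀ r)) z z' := by
    refine HasRatioLog.union hQc hcpt (fun x hx => ?_) hz'Q hzz' hB
    rw [hQp.connectedComponentIn hx]
    convert hβp using 1
    ext w
    constructor
    · rintro ⟨hw | hw, hwQ⟩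
      · exact hw
      · by_contra hwβ
        have := hβ ⟨hwQ, hwβ⟩
        rw [mem_ball, mem_sphere.1 hw] at this
        exact this.false
    · exact fun hw => ⟨Or.inl hw, hβQ hw⟩
  obtain ⟨I, hI, hIQ, hcl, hn⟩ := exists_arc_not_hasRatioLog hQc.isClosed hQp hr
    (ball_subset_ball (min_le_right _ _) hz) hy hyQ
  have hsub : Q ∪ circleMap z₀ r '' I ⊆ Q ∪ (β ∪ sphere z₀ r) := by
    refine union_subset_union_right _ ?_
    rintro _ ⟨θ, -, rfl⟩
    exact Or.inr (circleMap_mem_sphere _ hr.le θ)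
  exact ⟨I, hI, hIQ, hcl, hn, fun h => hn ((hU.mono hsub).trans h)⟩

namespace IsDomainHomeo

variable {φ ψ : ℂ → ℂ} {U V : Set ℂ}

theorem mem_closedBall_of_not_hasRatioLog (H : IsDomainHomeo φ ψ U V) {J M : Set ℂ}
    {z₀ p₀ y a : ℂ} {η : ℝ} (hz₀ : z₀ ∈ frontier U) (hp₀ : (z₀, p₀) ∈ closedGraph φ U)
    (hJ : Disjoint J (connectedComponentIn (frontier U) z₀))
    (hJc : IsClosed (connectedComponentIn (frontier U) z₀ ∪ J))
    (hM : IsClosed M) (hMp : IsPreconnected M) (hMP : M ⊆ connectedComponentIn (frontier V) p₀)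
    (hKM : closure (saturatedImage φ U V J) ∩ connectedComponentIn (frontier V) p₀ ⊆ M)
    (hMa : M ⊆ closedBall a η) (hKa : closure (saturatedImage φ U V J) ⊆ closedBall a η)
    (hy : y ∈ U) (hya : φ y ∉ closedBall a η) {z : ℂ} (hz : z ∈ U)
    (h : ¬HasRatioLog (connectedComponentIn (frontier U) z₀ ∪ J) z y) :
    φ z ∈ closedBall a η := by
  by_contra hza
  set K := saturatedImage φ U V J with hK
  have hBa : closure K ∪ M ⊆ closedBall a η := union_subset hKa hMa
  have hBc : IsCompact (closure K ∪ M) :=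
    (isCompact_closedBall a η).of_isClosed_subset (isClosed_closure.union hM) hBa
  have hdisj := H.disjoint_saturatedImage hz₀ hp₀ hJ
  have hcl := H.closure_saturatedImage_subset hz₀ hp₀ hJc
  have hcomp : ∀ x ∈ frontier V,
      IsPreconnected ((closure K ∪ M) ∩ connectedComponentIn (frontier V) x) := by
    intro x hx
    by_cases hxp : x ∈ connectedComponentIn (frontier V) p₀
    · rw [← connectedComponentIn_eq hxp]
      convert hMp using 1
      ext q
      constructor
      · rintro ⟨hq | hq, hqP⟩
        · exact hKM ⟨hq, hqP⟩
        · exact hq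
      · exact fun hq => ⟨Or.inr hq, hMP hq⟩
    · have hd : ∀ q ∈ connectedComponentIn (frontier V) x,
          q ∉ connectedComponentIn (frontier V) p₀ := by
        intro q hq hqp
        rw [connectedComponentIn_eq hqp, ← connectedComponentIn_eq hq] at hxp
        exact hxp (mem_connectedComponentIn hx)
      by_cases hne : ∃ q ∈ K, q ∈ connectedComponentIn (frontier V) x
      · obtain ⟨q, hqK, hq⟩ := hne
        have hs : connectedComponentIn (frontier V) x ⊆ K := by
          rw [connectedComponentIn_eq hq]
          exact connectedComponentIn_subset_saturatedImage hqK
        rw [inter_eq_right.2 (hs.trans (subset_closure.trans subset_union_left))]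
        exact isPreconnected_connectedComponentIn
      · convert isPreconnected_empty using 1
        rw [eq_empty_iff_forall_notMem]
        rintro q ⟨hq | hq, hqx⟩
        · rcases hcl hq with hq | hq
          · exact hne ⟨q, hq, hqx⟩
          · exact hd q hqx hq
        · exact hd q hqx (hMP hq)
  obtain ⟨E, hE, hEs, hzE, hyE⟩ := (HasRatioLog.of_subset_closedBall hBa hza hya
    ).exists_isPreconnected_subset H.isOpen_target H.isConnected_target.isPreconnected
    H.isBounded_target hBc hcomp ⟨H.mapsTo hz, fun hB => hza (hBa hB)⟩
    ⟨H.mapsTo hy, fun hB => hya (hBa hB)⟩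
  refine h (HasRatioLog.of_isPreconnected hJc (E := ψ '' E)
    (hE.image ψ (H.continuousOn_symm.mono fun v hv => (hEs hv).1)) ?_
    ⟨φ z, hzE, H.left_inv z hz⟩ ⟨φ y, hyE, H.left_inv y hy⟩)
  rw [disjoint_left]
  rintro _ ⟨v, hv, rfl⟩ (hQ | hvJ)
  · exact H.notMem_frontier_of_mem (H.mapsTo_symm (hEs hv).1) (connectedComponentIn_subset _ _ hQ)
  · refine (hEs hv).2 (Or.inl (subset_closure ⟨ψ v, hvJ, φ (ψ v),
      mk_mem _ (H.mapsTo_symm (hEs hv).1), Or.inl ?_⟩))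
    exact (H.right_inv v (hEs hv).1).symm

theorem exists_forall_mem_closedBall (H : IsDomainHomeo φ ψ U V) {I : Set ℝ} {c : ℝ → ℂ}
    {z₀ p₀ y : ℂ} {ε η : ℝ}
    (hz₀ : z₀ ∈ frontier U) (hp₀ : (z₀, p₀) ∈ closedGraph φ U)
    (hJ : Disjoint (c '' I) (connectedComponentIn (frontier U) z₀))
    (hJc : IsClosed (connectedComponentIn (frontier U) z₀ ∪ c '' I))
    (hy : y ∈ U) (hyη : closedBall (φ y) η ⊆ V) (hyJ : ∀ w ∈ c '' I, w ∈ U →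
      φ w ∉ closedBall (φ y) η) (hεη : ε ≤ η)
    (hM : ∀ a ∈ connectedComponentIn (frontier V) p₀,
      ∃ M ⊆ connectedComponentIn (frontier V) p₀, IsClosed M ∧ IsPreconnected M ∧
        connectedComponentIn (frontier V) p₀ ∩ closedBall a ε ⊆ M ∧ M ⊆ closedBall a η)
    (hK : ∀ p ∈ saturatedImage φ U V (c '' I), ∀ q ∈ saturatedImage φ U V (c '' I),
      dist p q ≤ ε) :
    ∃ a, ∀ z ∈ U, ¬HasRatioLog (connectedComponentIn (frontier U) z₀ ∪ c '' I) z y →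
      φ z ∈ closedBall a η := by
  set K := saturatedImage φ U V (c '' I) with hKdef
  have hKcl : ∀ p ∈ closure K, ∀ q ∈ closure K, dist p q ≤ ε := by
    intro p hp q hq
    have : (p, q) ∈ closure (K ×ˢ K) := by rw [closure_prod_eq]; exact ⟨hp, hq⟩
    refine closure_minimal (t := {x : ℂ × ℂ | dist x.1 x.2 ≤ ε}) ?_
      (isClosed_le (by fun_prop) continuous_const) this
    rintro ⟨p, q⟩ ⟨hp, hq⟩
    exact hK p hp q hq
  by_cases hne : (closure K ∩ connectedComponentIn (frontier V) p₀).Nonempty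
  · obtain ⟨a, haK, haP⟩ := hne
    obtain ⟨M, hMP, hMc, hMp, hMa, hMη⟩ := hM a haP
    refine ⟨a, fun z hz h => H.mem_closedBall_of_not_hasRatioLog hz₀ hp₀ hJ hJc hMc hMp hMP
      (fun q hq => hMa ⟨hq.2, hKcl _ hq.1 _ haK⟩) hMη
      (fun q hq => (hKcl _ hq _ haK).trans hεη) hy (fun hya => ?_) hz h⟩
    rw [mem_closedBall_comm] at hya
    exact H.symm.notMem_frontier_of_mem (hyη hya) (connectedComponentIn_subset _ _ haP)
  · by_cases hJU : ∃ w ∈ c '' I, w ∈ U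
    · obtain ⟨w, hwJ, hwU⟩ := hJU
      have hwK : φ w ∈ closure K := subset_closure ⟨w, hwJ, _, mk_mem w hwU, Or.inl rfl⟩
      refine ⟨φ w, fun z hz h => H.mem_closedBall_of_not_hasRatioLog hz₀ hp₀ hJ hJc
        isClosed_empty isPreconnected_empty (empty_subset _) (fun q hq => hne ⟨q, hq⟩)
        (empty_subset _) (fun q hq => (hKcl _ hq _ hwK).trans hεη) hy (fun hya => ?_) hz h⟩
      rw [mem_closedBall_comm] at hya
      exact hyJ w hwJ hwU hya
    · refine ⟨0, fun z hz h => (h ?_).elim⟩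
      refine HasRatioLog.of_isPreconnected hJc H.isConnected_source.isPreconnected ?_ hz hy
      rw [disjoint_left]
      rintro w hw (hwQ | hwJ)
      · exact H.notMem_frontier_of_mem hw (connectedComponentIn_subset _ _ hwQ)
      · exact hJU ⟨w, hwJ, hw⟩

theorem eq_of_mem_closedGraph (H : IsDomainHomeo φ ψ U V) (hφ : DifferentiableOn ℂ φ U)
    (hU : (NondegComponents (frontier U)).Countable)
    (hV : (NondegComponents (frontier V)).Countable)
    (hdiam : ∑' Q : ↥(NondegComponents (frontier V)), Metric.ediam (Q : Set ℂ) ≠ ⊤)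
    (hs : SigmaFiniteH1 (SingletonPart (frontier V))) {z₀ p p' : ℂ} (hz₀ : z₀ ∈ frontier U)
    (hQ : connectedComponentIn (frontier U) z₀ = {z₀} ∨
      IsJordanCurve (connectedComponentIn (frontier U) z₀))
    (hP : LocallyConnectedSpace ↥(connectedComponentIn (frontier V) p))
    (hp : (z₀, p) ∈ closedGraph φ U) (hp' : (z₀, p') ∈ closedGraph φ U) : p = p' := by
  by_contra hne
  have hd : 0 < dist p p' := dist_pos.2 hne
  obtain ⟨y, hy⟩ := H.isConnected_source.nonempty
  obtain ⟨η₀, hη₀, hη₀V⟩ := Metric.nhds_basis_closedBall.mem_iff.1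
    (H.isOpen_target.mem_nhds (H.mapsTo hy))
  set η := min η₀ (dist p p' / 5) with hη
  have hηpos : 0 < η := lt_min hη₀ (by positivity)
  have hηd : η ≤ dist p p' / 5 := min_le_right _ _
  have hηV : closedBall (φ y) η ⊆ V := (closedBall_subset_closedBall (min_le_left _ _)).trans hη₀V
  have hcpt : IsCompact (ψ '' closedBall (φ y) η) :=
    (isCompact_closedBall _ _).image_of_continuousOn (H.continuousOn_symm.mono hηV)
  have hz₀c : z₀ ∉ ψ '' closedBall (φ y) η := by
    rintro ⟨v, hv, h⟩
    exact H.notMem_frontier_of_mem (H.mapsTo_symm (hηV hv)) (h ▸ hz₀)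
  obtain ⟨R, hR, hRs⟩ := Metric.isOpen_iff.1 hcpt.isClosed.isOpen_compl z₀ hz₀c
  have hPc : IsCompact (connectedComponentIn (frontier V) p) :=
    H.symm.isCompact_frontier.of_isClosed_subset (isClosed_connectedComponentIn_of_isClosed
      H.symm.isCompact_frontier.isClosed _) (connectedComponentIn_subset _ _)
  have hQc : IsCompact (connectedComponentIn (frontier U) z₀) :=
    H.isCompact_frontier.of_isClosed_subset (isClosed_connectedComponentIn_of_isClosed
      H.isCompact_frontier.isClosed _) (connectedComponentIn_subset _ _)
  obtain ⟨ε₀, hε₀, hM⟩ := exists_isPreconnected_between hPc hP hηpos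
  obtain ⟨r, hr, hrK⟩ := H.exists_radius_dist_le hφ hU hV hdiam hs hz₀ hp (lt_min hε₀ hηpos) hR
  obtain ⟨δ, hδ, hδI⟩ := exists_arc_not_hasRatioLog_pair hQc isPreconnected_connectedComponentIn
    (mem_connectedComponentIn hz₀) hQ hr.1
  have hUQ : Disjoint U (connectedComponentIn (frontier U) z₀) := disjoint_left.2 fun w hw hwQ =>
    H.notMem_frontier_of_mem hw (connectedComponentIn_subset _ _ hwQ)
  have hnear : ∀ q, (z₀, q) ∈ closedGraph φ U → ∃ z ∈ U, z ∈ ball z₀ δ ∧ φ z ∈ ball q η := by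
    intro q hq
    obtain ⟨_, ⟨h1, h2⟩, z, hz, rfl⟩ := mem_closure_iff.1 hq (ball z₀ δ ×ˢ ball q η)
      (isOpen_ball.prod isOpen_ball) ⟨mem_ball_self hδ, mem_ball_self hηpos⟩
    exact ⟨z, hz, h1, h2⟩
  obtain ⟨z, hzU, hzδ, hzp⟩ := hnear p hp
  obtain ⟨z', hz'U, hz'δ, hz'p⟩ := hnear p' hp'
  have hyR : y ∉ closedBall z₀ r := by
    intro h
    refine hRs (mem_ball.2 ((mem_closedBall.1 h).trans_lt hr.2)) ⟨φ y, ?_, H.left_inv y hy⟩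
    exact mem_closedBall_self hηpos.le
  obtain ⟨I, hI, hIQ, hcl, hn, hn'⟩ := hδI z hzδ z' hz'δ (disjoint_left.1 hUQ hz'U)
    (HasRatioLog.of_isPreconnected hQc.isClosed H.isConnected_source.isPreconnected hUQ hzU hz'U)
    y hyR (disjoint_left.1 hUQ hy)
  have hJs : circleMap z₀ r '' I ⊆ sphere z₀ r := by
    rintro _ ⟨θ, -, rfl⟩
    exact circleMap_mem_sphere _ hr.1.le θ
  have hJQ : Disjoint (circleMap z₀ r '' I) (connectedComponentIn (frontier U) z₀) := by
    rw [disjoint_left]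
    rintro _ ⟨θ, hθ, rfl⟩
    exact hIQ θ hθ
  obtain ⟨a, ha⟩ := H.exists_forall_mem_closedBall hz₀ hp hJQ hcl
    hy hηV (fun w hw hwU hwη => hRs (ball_subset_ball le_rfl (mem_ball.2
      ((mem_sphere.1 (hJs hw)).trans_lt hr.2))) ⟨φ w, hwη, H.left_inv w hwU⟩)
    (min_le_right ε₀ η)
    (fun a ha => by
      obtain ⟨M, h1, h2, h3, h4, h5⟩ := hM a ha
      exact ⟨M, h1, h2, h3, (inter_subset_inter_right _
        (closedBall_subset_closedBall (min_le_left _ _))).trans h4, h5⟩)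
    (hrK _ (saturatedImage_mono hJs) (H.isPreconnected_saturatedImage (continuous_circleMap z₀ r) hI)
      (H.disjoint_saturatedImage hz₀ hp hJQ))
  have h1 := mem_closedBall.1 (ha z hzU hn)
  have h2 := mem_closedBall.1 (ha z' hz'U hn')
  have h3 := mem_ball'.1 hzp
  have h4 := mem_ball.1 hz'p
  have h5 := dist_triangle4 p (φ z) (φ z') p'
  have h6 := dist_triangle_right (φ z) (φ z') a
  linarith

end IsDomainHomeo

theorem IsConformalHomeoOnto.isDomainHomeo {φ : ℂ → ℂ} {U V : Set ℂ}
    (h : IsConformalHomeoOnto φ U V) (hU : IsPlanarDomain U) (hUb : Bornology.IsBounded U)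
    (hV : IsPlanarDomain V) (hVb : Bornology.IsBounded V) :
    IsDomainHomeo φ (Function.invFunOn φ U) U V := by
  obtain ⟨hd, hb⟩ := h
  have hinv : InvOn (Function.invFunOn φ U) φ U V := hb.invOn_invFunOn
  have hmaps : MapsTo (Function.invFunOn φ U) V U := hb.surjOn.mapsTo_invFunOn
  have hopen : ∀ s ⊆ U, IsOpen s → IsOpen (φ '' s) := by
    refine ((hd.analyticOnNhd hU.2.1).is_constant_or_isOpen hU.2.2.isPreconnected).resolve_left ?_
    rintro ⟨w, hw⟩
    obtain ⟨z, hz⟩ := hU.1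
    refine not_isOpen_singleton z ?_
    convert hU.2.1
    exact (eq_singleton_iff_unique_mem.2 ⟨hz, fun x hx =>
      hb.injOn hx hz ((hw x hx).trans (hw z hz).symm)⟩).symm
  refine ⟨hU.2.1, hV.2.1, hU.2.2, hV.2.2, hUb, hVb, hd.continuousOn, ?_, hb.mapsTo, hmaps,
    hinv.1, hinv.2⟩
  rw [continuousOn_open_iff hV.2.1]
  intro t ht
  convert hopen (U ∩ t) inter_subset_left (hU.2.1.inter ht) using 1
  ext p
  constructor
  · exact fun ⟨hp, hpt⟩ => ⟨_, ⟨hmaps hp, hpt⟩, hinv.2 hp⟩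
  · rintro ⟨z, ⟨hz, hzt⟩, rfl⟩
    refine ⟨hb.mapsTo hz, ?_⟩
    rwa [mem_preimage, hinv.1 hz]

/-- First generalization of the continuity theorem, for generalized Jordan domains. -/
theorem stmt_18 (Ω₁ Ω₂ : Set ℂ) (φ : ℂ → ℂ)
    (hΩ₁ : IsGeneralizedJordanDomain Ω₁)
    (hΩ₂ : IsPlanarDomain Ω₂) (hΩ₂b : Bornology.IsBounded Ω₂)
    (hcount : (NondegComponents (frontier Ω₂)).Countable)
    (hdiam : ∑' Q : ↥(NondegComponents (frontier Ω₂)), EMetric.diam (Q : Set ℂ) < ⊤)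
    (hsing : SigmaFiniteH1 (SingletonPart (frontier Ω₂)))
    (hφ : IsConformalHomeoOnto φ Ω₁ Ω₂) :
    (∃ φb : ℂ → ℂ, ExtendsContinuously φ φb Ω₁ Ω₂) ↔
      IsPeanoCompactum (frontier Ω₂) := by
  have H := hφ.isDomainHomeo hΩ₁.1 hΩ₁.2.1 hΩ₂ hΩ₂b
  obtain ⟨-, -, hP, hJ⟩ := hΩ₁
  constructor
  · rintro ⟨φb, h⟩
    exact ⟨H.symm.isCompact_frontier, fun p hp =>
      H.locallyConnectedSpace_of_extendsContinuously h hP.2.1 hp,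
      fun C hC => finite_setOf_lt_diam hdiam hC⟩
  · intro h
    exact H.exists_extendsContinuously fun z hz p p' hp hp' => H.eq_of_mem_closedGraph hφ.1
      hP.countable_nondegComponents hcount hdiam.ne hsing hz (hJ z hz)
      (h.2.1 p (H.snd_mem_frontier hp hz)) hp hp'
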